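/- Let g be a psd sextic form in ℝ[x₀,x₁,x₂] that is not a sum of squares of forms. Then the real projective zero set V_ℝ(g) has at most 10 points. If moreover the image of g in ℂ[x₀,x₁,x₂] is reducible, then V_ℝ(g) has at most 9 points. -/

import Mathlib

open MvPolynomial

noncomputable section

/-- The real projective plane, as lines through the origin of `ℝ³`. -/
abbrev P2 := Projectivization ℝ (Fin 3 → ℝ)

/-- A polynomial is psd if it takes only nonnegative values on `ℝ³`. -/
def Psd (g : MvPolynomial (Fin 3) ℝ) : Prop := ∀ u : Fin 3 → ℝ, 0 ≤ eval u g

/-- A polynomial is sos if it is a finite sum of squares. -/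
def Sos (g : MvPolynomial (Fin 3) ℝ) : Prop :=
  ∃ (n : ℕ) (h : Fin n → MvPolynomial (Fin 3) ℝ), g = ∑ i, (h i) ^ 2

/-- A form vanishes at a point of `ℙ²(ℝ)` if it vanishes at a representative vector. -/
def VanishAt (g : MvPolynomial (Fin 3) ℝ) (P : P2) : Prop := eval P.rep g = 0

/-- A form is singular at a point of `ℙ²(ℝ)` if it and all its first partial
derivatives vanish at a representative vector. -/
def SingAt (g : MvPolynomial (Fin 3) ℝ) (P : P2) : Prop :=
  eval P.rep g = 0 ∧ ∀ i, eval P.rep (pderiv i g) = 0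

/-- `I_d(T)`: the space of degree-`d` forms vanishing at every point of `T`. -/
def Isub (d : ℕ) (T : Set P2) : Submodule ℝ (MvPolynomial (Fin 3) ℝ) :=
  (homogeneousSubmodule (Fin 3) ℝ d) ⊓
  { carrier := {f | ∀ P ∈ T, VanishAt f P}
    zero_mem' := by intro P _; simp [VanishAt]
    add_mem' := by
      intro a b ha hb P hP
      have h1 := ha P hP; have h2 := hb P hP
      unfold VanishAt at *; simp [h1, h2]
    smul_mem' := by
      intro c f hf P hP
      have h1 := hf P hP
      unfold VanishAt at *; simp [smul_eq_C_mul, h1] }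

/-- `I_d(2T)`: the space of degree-`d` forms singular at every point of `T`. -/
def Isub2 (d : ℕ) (T : Set P2) : Submodule ℝ (MvPolynomial (Fin 3) ℝ) :=
  (homogeneousSubmodule (Fin 3) ℝ d) ⊓
  { carrier := {f | ∀ P ∈ T, SingAt f P}
    zero_mem' := by intro P _; constructor <;> simp [SingAt]
    add_mem' := by
      intro a b ha hb P hP
      obtain ⟨h1, h2⟩ := ha P hP; obtain ⟨h3, h4⟩ := hb P hP
      exact ⟨by simp [h1, h3], fun i => by simp [h2 i, h4 i]⟩
    smul_mem' := by
      intro c f hf P hP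
      obtain ⟨h1, h2⟩ := hf P hP
      refine ⟨by simp [smul_eq_C_mul, h1], fun i => ?_⟩
      have := h2 i
      simp [smul_eq_C_mul, this] }

/-- `I₃(T)²`: the span of products of two cubics vanishing on `T`. -/
def IsqCubic (T : Set P2) : Submodule ℝ (MvPolynomial (Fin 3) ℝ) :=
  Submodule.span ℝ {h | ∃ f₁ ∈ Isub 3 T, ∃ f₂ ∈ Isub 3 T, h = f₁ * f₂}

/-- No 4 points of `T` on a line, no 7 on a conic. -/
def GenPos (T : Set P2) : Prop :=
  (∀ l : MvPolynomial (Fin 3) ℝ, l ≠ 0 → l.IsHomogeneous 1 →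
    {P ∈ T | VanishAt l P}.encard ≤ 3) ∧
  (∀ c : MvPolynomial (Fin 3) ℝ, c ≠ 0 → c.IsHomogeneous 2 →
    {P ∈ T | VanishAt c P}.encard ≤ 6)

/-- The real projective zero set of `g`. -/
def VR (g : MvPolynomial (Fin 3) ℝ) : Set P2 := {P | VanishAt g P}


section

open MvPolynomial


section Homog
variable {K : Type*} [Field K] {σ : Type*}

/-- the substitution `x_i ↦ x_i t`. -/
def scaleHom (K : Type*) [Field K] (σ : Type*) :
    MvPolynomial σ K →ₐ[K] Polynomial (MvPolynomial σ K) :=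
  aeval (fun i => Polynomial.C (X i) * Polynomial.X)

lemma scaleHom_monomial (s : σ →₀ ℕ) (a : K) :
    scaleHom K σ (monomial s a) = Polynomial.monomial s.degree (monomial s a) := by
  unfold scaleHom
  rw [aeval_monomial, Finsupp.degree_apply]
  simp only [mul_pow, Finsupp.prod]
  rw [Finset.prod_mul_distrib, Finset.prod_pow_eq_pow_sum, ← Polynomial.C_mul_X_pow_eq_monomial, monomial_eq]
  simp only [Finsupp.prod, Polynomial.C_mul, map_prod, map_pow]
  rw [← mul_assoc]
  rfl

lemma scaleHom_coeff (p : MvPolynomial σ K) (k : ℕ) :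
    (scaleHom K σ p).coeff k = homogeneousComponent k p := by
  induction p using MvPolynomial.induction_on' with
  | monomial s a =>
    rw [scaleHom_monomial, Polynomial.coeff_monomial]
    split_ifs with h
    · rw [homogeneousComponent_eq_self]
      exact isHomogeneous_monomial _ h
    · rw [homogeneousComponent_of_mem (isHomogeneous_monomial a rfl), if_neg]
      exact fun h' => h h'.symm
  | add p q hp hq => simp [hp, hq]

lemma scaleHom_inj {p : MvPolynomial σ K} (hp : p ≠ 0) : scaleHom K σ p ≠ 0 := by
  intro h
  apply hp
  rw [← sum_homogeneousComponent p]
  apply Finset.sum_eq_zero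
  intro i _
  rw [← scaleHom_coeff, h]; simp

lemma homog_of_scale {p : MvPolynomial σ K} {n : ℕ}
    (h1 : (scaleHom K σ p).natDegree ≤ n) (h2 : n ≤ (scaleHom K σ p).natTrailingDegree) :
    p.IsHomogeneous n := by
  have : p = homogeneousComponent n p := by
    conv_lhs => rw [← sum_homogeneousComponent p]
    have key : ∀ i, i ≠ n → homogeneousComponent i p = 0 := by
      intro i hi
      rw [← scaleHom_coeff]
      rcases lt_or_gt_of_ne hi with h | h
      · exact Polynomial.coeff_eq_zero_of_lt_natTrailingDegree (by omega)
      · exact Polynomial.coeff_eq_zero_of_natDegree_lt (by omega)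
    by_cases hn : n ∈ Finset.range (p.totalDegree + 1)
    · rw [Finset.sum_eq_single_of_mem n hn (fun i _ hi => key i hi)]
    · rw [Finset.sum_eq_zero]
      · symm; apply homogeneousComponent_eq_zero
        simpa using hn
      · intro i hi; apply key; rintro rfl; exact hn hi
  rw [this]; exact homogeneousComponent_isHomogeneous _ _

lemma scale_of_homog {p : MvPolynomial σ K} {n : ℕ} (hp : p.IsHomogeneous n) :
    scaleHom K σ p = Polynomial.monomial n p := by
  ext1 k
  rw [scaleHom_coeff, Polynomial.coeff_monomial, homogeneousComponent_of_mem hp]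
  simp only [eq_comm]

/-- Factors of a nonzero form are forms. -/
lemma homog_factor {p q : MvPolynomial σ K} {n : ℕ} (h : (p * q).IsHomogeneous n)
    (h0 : p * q ≠ 0) : ∃ i j, i + j = n ∧ p.IsHomogeneous i ∧ q.IsHomogeneous j := by
  have hp : p ≠ 0 := left_ne_zero_of_mul h0
  have hq : q ≠ 0 := right_ne_zero_of_mul h0
  have hs := scale_of_homog h
  rw [map_mul] at hs
  have hp' := scaleHom_inj hp
  have hq' := scaleHom_inj hq
  have e1 := Polynomial.natDegree_mul hp' hq'
  have e2 := Polynomial.natTrailingDegree_mul hp' hq'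
  rw [hs, Polynomial.natDegree_monomial_eq _ h0] at e1
  rw [hs, Polynomial.natTrailingDegree_monomial h0] at e2
  have l1 := Polynomial.natTrailingDegree_le_natDegree (scaleHom K σ p)
  have l2 := Polynomial.natTrailingDegree_le_natDegree (scaleHom K σ q)
  exact ⟨_, _, e1.symm, homog_of_scale le_rfl (by omega), homog_of_scale le_rfl (by omega)⟩

end Homog

end

section

open MvPolynomial


section Dim
variable {K : Type*} [Field K]

/-- exponents of degree `n`. -/
abbrev Mon (n : ℕ) : Finset (Fin 3 →₀ ℕ) := Finset.finsuppAntidiag (Finset.univ : Finset (Fin 3)) n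

lemma mem_Mon {n : ℕ} {s : Fin 3 →₀ ℕ} : s ∈ Mon n ↔ s.degree = n := by
  rw [Finset.mem_finsuppAntidiag, Finsupp.degree_eq_sum]
  simp

lemma form_eq_sum {n : ℕ} {p : MvPolynomial (Fin 3) K} (hp : p.IsHomogeneous n) :
    p = ∑ s ∈ Mon n, monomial s (coeff s p) := by
  conv_lhs => rw [p.as_sum]
  apply Finset.sum_subset
  · intro s hs
    rw [mem_Mon]
    by_contra h
    exact (mem_support_iff.1 hs) (hp.coeff_eq_zero h)
  · intro s _ hs
    rw [notMem_support_iff.1 hs]; simp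

/-- the coefficient map on forms. -/
def coefMap (K : Type*) [Field K] (n : ℕ) : homogeneousSubmodule (Fin 3) K n →ₗ[K] (Mon n → K) :=
  LinearMap.pi (fun s => (lcoeff K (s : Fin 3 →₀ ℕ)) ∘ₗ (homogeneousSubmodule (Fin 3) K n).subtype)

lemma coefMap_bij (n : ℕ) : Function.Bijective (coefMap K n) := by
  constructor
  · rw [← LinearMap.ker_eq_bot, LinearMap.ker_eq_bot']
    rintro ⟨p, hp⟩ h
    ext1
    change p = 0
    rw [form_eq_sum hp]
    apply Finset.sum_eq_zero
    intro s hs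
    have := congrFun h ⟨s, hs⟩
    change coeff s p = 0 at this
    rw [this]; simp
  · intro c
    refine ⟨⟨∑ s : Mon n, monomial (s : Fin 3 →₀ ℕ) (c s), ?_⟩, ?_⟩
    · apply Submodule.sum_mem
      intro s _
      exact isHomogeneous_monomial _ (mem_Mon.1 s.2)
    · ext t
      change coeff (t : Fin 3 →₀ ℕ) (∑ s : Mon n, monomial (s : Fin 3 →₀ ℕ) (c s)) = c t
      rw [coeff_sum, Finset.sum_eq_single t]
      · simp
      · intro s _ hs
        rw [coeff_monomial, if_neg]
        exact fun h => hs (Subtype.ext h)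
      · simp

instance finDimForms (n : ℕ) : FiniteDimensional K (homogeneousSubmodule (Fin 3) K n) :=
  (LinearEquiv.ofBijective _ (coefMap_bij (K := K) n)).symm.finiteDimensional

lemma finrank_forms (n : ℕ) :
    Module.finrank K (homogeneousSubmodule (Fin 3) K n) = (n + 2).choose 2 := by
  rw [(LinearEquiv.ofBijective _ (coefMap_bij (K := K) n)).finrank_eq, Module.finrank_fintype_fun_eq_card,
    Fintype.card_coe, Finset.card_finsuppAntidiag_nat_eq_choose]
  · simp
    rw [add_comm 2 n]; exact Nat.choose_symm_of_eq_add rfl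

lemma choose_id (d e k : ℕ) :
    (d + e + k + 2).choose 2 + (k + 2).choose 2 =
      (d + k + 2).choose 2 + (e + k + 2).choose 2 + d * e := by
  have h : ∀ n : ℕ, ((n + 2).choose 2 : ℚ) = (n + 2) * (n + 1) / 2 := by
    intro n
    rw [Nat.cast_choose_two]; push_cast; ring
  have : (((d + e + k + 2).choose 2 + (k + 2).choose 2 : ℕ) : ℚ) =
      (((d + k + 2).choose 2 + (e + k + 2).choose 2 + d * e : ℕ) : ℚ) := by
    push_cast
    rw [h, h, h, h]; push_cast; ring
  exact_mod_cast this

end Dim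

section Bez
variable {K : Type*} [Field K]

/-- Bezout by dimension count. -/
lemma bezout_dim {f g : MvPolynomial (Fin 3) K} {d e k : ℕ} (hg : g.IsHomogeneous d)
    (hf : f.IsHomogeneous e) (hgp : Prime g) (hgf : ¬ g ∣ f)
    {W : Type*} [AddCommGroup W] [Module K W] [FiniteDimensional K W]
    (Φ : homogeneousSubmodule (Fin 3) K (d + e + k) →ₗ[K] W) (hΦ : Function.Surjective Φ)
    (h1 : ∀ F : homogeneousSubmodule (Fin 3) K (d + e + k), f ∣ F → Φ F = 0)
    (h2 : ∀ F : homogeneousSubmodule (Fin 3) K (d + e + k), g ∣ F → Φ F = 0) :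
    Module.finrank K W ≤ d * e := by
  let m : (homogeneousSubmodule (Fin 3) K (d + k) × homogeneousSubmodule (Fin 3) K (e + k)) →ₗ[K]
      homogeneousSubmodule (Fin 3) K (d + e + k) :=
    LinearMap.codRestrict _
      (LinearMap.coprod (LinearMap.mulLeft K f ∘ₗ (homogeneousSubmodule (Fin 3) K (d + k)).subtype)
        (LinearMap.mulLeft K g ∘ₗ (homogeneousSubmodule (Fin 3) K (e + k)).subtype))
      (by
        rintro ⟨⟨a, ha⟩, ⟨b, hb⟩⟩
        apply Submodule.add_mem
        · have := hf.mul ha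
          rw [show e + (d + k) = d + e + k by ring] at this
          exact this
        · have := hg.mul hb
          rw [show d + (e + k) = d + e + k by ring] at this
          exact this)
  have hm : ∀ a b, ((m (a, b) : homogeneousSubmodule (Fin 3) K (d + e + k)) :
      MvPolynomial (Fin 3) K) = f * a + g * b := fun a b => rfl
  have hg0 : g ≠ 0 := hgp.ne_zero
  -- kernel
  let j : homogeneousSubmodule (Fin 3) K k →ₗ[K]
      (homogeneousSubmodule (Fin 3) K (d + k) × homogeneousSubmodule (Fin 3) K (e + k)) :=
    LinearMap.prod
      (LinearMap.codRestrict _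
        (LinearMap.mulLeft K g ∘ₗ (homogeneousSubmodule (Fin 3) K k).subtype)
          (by rintro ⟨c, hc⟩; exact hg.mul hc))
      (LinearMap.codRestrict _
        (- LinearMap.mulLeft K f ∘ₗ (homogeneousSubmodule (Fin 3) K k).subtype)
          (by rintro ⟨c, hc⟩; exact Submodule.neg_mem _ (hf.mul hc)))
  have hker : LinearMap.ker m ≤ LinearMap.range j := by
    rintro ⟨⟨a, ha⟩, ⟨b, hb⟩⟩ hab
    rw [LinearMap.mem_ker] at hab
    have e1 : f * a + g * b = 0 := by
      have := congrArg Subtype.val hab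
      rwa [hm] at this
    have hga : g ∣ a := by
      have : g ∣ f * a := ⟨-b, by linear_combination e1⟩
      exact (hgp.dvd_or_dvd this).resolve_left hgf
    obtain ⟨c, rfl⟩ := hga
    have e2 : b = - (f * c) := by
      have : g * (b + f * c) = 0 := by linear_combination e1
      have := (mul_eq_zero.1 this).resolve_left hg0
      linear_combination this
    have hc : c.IsHomogeneous k := by
      by_cases hc0 : c = 0
      · rw [hc0]; exact isHomogeneous_zero _ _ _
      · obtain ⟨i, l, hil, hi, hl⟩ := homog_factor ha (mul_ne_zero hg0 hc0)
        have := hg.inj_right hi hg0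
        have : l = k := by omega
        rwa [this] at hl
    refine ⟨⟨c, hc⟩, ?_⟩
    ext1 <;> ext1
    · rfl
    · change - (f * c) = b
      exact e2.symm
  have hle : LinearMap.range m ≤ LinearMap.ker Φ := by
    rintro _ ⟨⟨a, b⟩, rfl⟩
    rw [LinearMap.mem_ker]
    have : ((a, b) : _ × _) = (a, 0) + (0, b) := by simp
    rw [this, map_add, map_add, h1, h2, add_zero]
    · rw [hm]; simp
    · rw [hm]; simp
  have r1 := LinearMap.finrank_range_add_finrank_ker m
  have r2 := LinearMap.finrank_range_add_finrank_ker Φ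
  rw [LinearMap.range_eq_top.2 hΦ, finrank_top] at r2
  have r3 := Submodule.finrank_mono hker
  have r4 := LinearMap.finrank_range_le j
  have r5 := Submodule.finrank_mono hle
  rw [Module.finrank_prod] at r1
  rw [finrank_forms] at *
  rw [finrank_forms] at r1
  have := choose_id d e k
  omega

end Bez

end

section

open MvPolynomial


section Points
variable {K : Type*} [Field K]

lemma exists_lin {x y : Fin 3 → K} (h : ∀ t : K, x ≠ t • y) :
    ∃ c : Fin 3 → K, c ⬝ᵥ y = 0 ∧ c ⬝ᵥ x ≠ 0 := by
  have : x ∉ Submodule.span K {y} := by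
    rw [Submodule.mem_span_singleton]
    rintro ⟨t, ht⟩
    exact h t ht.symm
  obtain ⟨φ, hx, hy⟩ := Submodule.exists_le_ker_of_notMem this
  have key : ∀ z, φ z = (fun k => φ (fun j => if k = j then 1 else 0)) ⬝ᵥ z := by
    intro z
    rw [LinearMap.pi_apply_eq_sum_univ φ z, dotProduct]
    apply Finset.sum_congr rfl
    intro i _
    rw [smul_eq_mul, mul_comm]
  refine ⟨fun k => φ (fun j => if k = j then 1 else 0), ?_, ?_⟩
  · rw [← key]; exact hy (Submodule.mem_span_singleton_self y)
  · rw [← key]; exact hx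

lemma exists_lin2 {p v : Fin 3 → K} (hp : p ≠ 0) (h : ∀ t : K, v ≠ t • p) (α β : K) :
    ∃ c : Fin 3 → K, c ⬝ᵥ p = α ∧ c ⬝ᵥ v = β := by
  have h' : ∀ t : K, p ≠ t • v := by
    intro t ht
    have ht0 : t ≠ 0 := by
      rintro rfl; apply hp; simpa using ht
    apply h t⁻¹
    rw [ht, smul_smul, inv_mul_cancel₀ ht0, one_smul]
  obtain ⟨c1, h1, h2⟩ := exists_lin h
  obtain ⟨c2, h3, h4⟩ := exists_lin h'
  refine ⟨(α / (c2 ⬝ᵥ p)) • c2 + (β / (c1 ⬝ᵥ v)) • c1, ?_, ?_⟩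
  · rw [add_dotProduct, smul_dotProduct, smul_dotProduct, h1]; simp [h4]
  · rw [add_dotProduct, smul_dotProduct, smul_dotProduct, h3]; simp [h2]

lemma exists_ker (c p : Fin 3 → K) : ∃ v : Fin 3 → K, c ⬝ᵥ v = 0 ∧ ∀ t : K, v ≠ t • p := by
  let φ : (Fin 3 → K) →ₗ[K] K :=
    { toFun := fun v => c ⬝ᵥ v
      map_add' := fun a b => dotProduct_add _ _ _
      map_smul' := fun a b => by simp }
  by_contra hcon
  push Not at hcon
  have hle : LinearMap.ker φ ≤ Submodule.span K {p} := by
    intro v hv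
    obtain ⟨t, ht⟩ := hcon v hv
    rw [Submodule.mem_span_singleton]; exact ⟨t, ht.symm⟩
  have r1 := LinearMap.finrank_range_add_finrank_ker φ
  have r2 := Submodule.finrank_mono hle
  have r3 : Module.finrank K (Submodule.span K {p}) ≤ 1 := by
    have := finrank_span_le_card (R := K) ({p} : Set (Fin 3 → K))
    simpa using this
  have r4 := Submodule.finrank_le (LinearMap.range φ)
  simp at r1 r4
  omega

/-- The linear form with coefficients `c`. -/
def linF (c : Fin 3 → K) : MvPolynomial (Fin 3) K := ∑ k, C (c k) * X k

lemma linF_homog (c : Fin 3 → K) : (linF c).IsHomogeneous 1 :=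
  IsHomogeneous.sum _ _ _ (fun _ _ => isHomogeneous_C_mul_X _ _)

lemma eval_linF (c p : Fin 3 → K) : eval p (linF c) = c ⬝ᵥ p := by
  simp [linF, dotProduct]

lemma pderiv_linF (c : Fin 3 → K) (k : Fin 3) : pderiv k (linF c) = C (c k) := by
  fin_cases k <;> simp [linF, Fin.sum_univ_three, pderiv_X]

/-- directional derivative -/
def dirD (v p : Fin 3 → K) (F : MvPolynomial (Fin 3) K) : K :=
  ∑ k, v k * eval p (pderiv k F)

lemma dirD_mul (v p : Fin 3 → K) (F G : MvPolynomial (Fin 3) K) :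
    dirD v p (F * G) = dirD v p F * eval p G + eval p F * dirD v p G := by
  simp only [dirD, Derivation.leibniz, Finset.sum_mul, Finset.mul_sum, ← Finset.sum_add_distrib]
  apply Finset.sum_congr rfl
  intro k _
  simp; ring

lemma dirD_linF (v p c : Fin 3 → K) : dirD v p (linF c) = c ⬝ᵥ v := by
  simp [dirD, pderiv_linF, dotProduct, mul_comm]

lemma dirD_sum {ι : Type*} (s : Finset ι) (v p : Fin 3 → K) (F : ι → MvPolynomial (Fin 3) K) :
    dirD v p (∑ i ∈ s, F i) = ∑ i ∈ s, dirD v p (F i) := by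
  simp only [dirD, map_sum, Finset.mul_sum]
  rw [Finset.sum_comm]

lemma dirD_sq (v p : Fin 3 → K) (F G : MvPolynomial (Fin 3) K) (h : eval p F = 0) :
    dirD v p (F ^ 2 * G) = 0 := by
  rw [dirD_mul, sq, dirD_mul]; simp [h]

/-- separating forms -/
lemma exists_sep {ι : Type*} [Fintype ι] [DecidableEq ι] (P : ι → Fin 3 → K) (i : ι)
    (hP : ∀ j, i ≠ j → ∀ t : K, P i ≠ t • P j) (hP0 : P i ≠ 0) (k : ℕ) :
    ∃ L : MvPolynomial (Fin 3) K, L.IsHomogeneous (2 * (Fintype.card ι - 1) + k) ∧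
      eval (P i) L ≠ 0 ∧ ∀ j, i ≠ j → ∃ F G, L = F ^ 2 * G ∧ eval (P j) F = 0 := by
  have h1 : ∀ j, ∃ c : Fin 3 → K, i ≠ j → c ⬝ᵥ P j = 0 ∧ c ⬝ᵥ P i ≠ 0 := by
    intro j
    by_cases h : i = j
    · exact ⟨0, fun h' => absurd h h'⟩
    · obtain ⟨c, hc⟩ := exists_lin (hP j h)
      exact ⟨c, fun _ => hc⟩
  choose c hc using h1
  obtain ⟨r, -, hr⟩ := exists_lin (x := P i) (y := 0) (by intro t; simpa using hP0)
  refine ⟨(∏ j ∈ Finset.univ.erase i, linF (c j)) ^ 2 * linF r ^ k, ?_, ?_, ?_⟩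
  · have e1 := (IsHomogeneous.prod (Finset.univ.erase i) (fun j => linF (c j)) (fun _ => 1)
      (fun j _ => linF_homog (c j))).pow 2
    have e2 := (linF_homog r).pow k
    have := e1.mul e2
    convert this using 1
    simp [Finset.card_erase_of_mem]; ring
  · simp only [map_mul, map_pow, map_prod, eval_linF]
    refine mul_ne_zero (pow_ne_zero _ ?_) (pow_ne_zero _ hr)
    rw [Finset.prod_ne_zero_iff]
    intro j hj
    exact (hc j (Finset.ne_of_mem_erase hj).symm).2
  · intro j hij
    refine ⟨_, _, rfl, ?_⟩
    rw [map_prod]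
    apply Finset.prod_eq_zero (i := j)
    · simp [Ne.symm hij]
    · rw [eval_linF]; exact (hc j hij).1

/-- Bezout, counting singular points twice. -/
theorem bezout_points {f g : MvPolynomial (Fin 3) K} {d e : ℕ} (hg : g.IsHomogeneous d)
    (hf : f.IsHomogeneous e) (hgp : Prime g) (hgf : ¬ g ∣ f)
    {ι : Type*} [Fintype ι] [DecidableEq ι] (P : ι → Fin 3 → K) (hP0 : ∀ i, P i ≠ 0)
    (hP : ∀ i j, i ≠ j → ∀ t : K, P i ≠ t • P j) (hfP : ∀ i, eval (P i) f = 0)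
    (hgP : ∀ i, eval (P i) g = 0) (J : Finset ι)
    (hJ : ∀ i ∈ J, ∀ k, eval (P i) (pderiv k g) = 0) :
    Fintype.card ι + J.card ≤ d * e := by
  by_cases hemp : Fintype.card ι = 0
  · have : J.card ≤ Fintype.card ι := Finset.card_le_univ J
    omega
  have hv : ∀ i, ∃ v : Fin 3 → K, dirD v (P i) f = 0 ∧ ∀ t : K, v ≠ t • P i := by
    intro i
    obtain ⟨v, hv, hv'⟩ := exists_ker (fun k => eval (P i) (pderiv k f)) (P i)
    refine ⟨v, ?_, hv'⟩
    rw [← hv]; simp [dirD, dotProduct, mul_comm]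
  choose v hv hv' using hv
  set N := Fintype.card ι with hN
  set k := 2 * (N - 1) + 1 with hk
  let Φ : homogeneousSubmodule (Fin 3) K (d + e + k) →ₗ[K] ((ι → K) × (J → K)) :=
    { toFun := fun F => (fun i => eval (P i) F.1, fun i => dirD (v i) (P i) F.1)
      map_add' := by
        intro F G
        ext i
        · simp
        · simp [dirD, mul_add, Finset.sum_add_distrib]
      map_smul' := by
        intro a F
        ext i
        · simp
        · simp only [dirD, Finset.mul_sum, Submodule.coe_smul, Derivation.map_smul, smul_eval,
            RingHom.id_apply, Prod.smul_mk, Pi.smul_apply, smul_eq_mul]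
          exact Finset.sum_congr rfl fun x _ => by ring }
  have hΦ : Function.Surjective Φ := by
    rintro ⟨α, β⟩
    have hL : ∀ i, _ := fun i => exists_sep P i (hP i) (hP0 i) (d + e)
    choose L hL1 hL2 hL3 using hL
    have hm : ∀ i, ∃ c : Fin 3 → K, c ⬝ᵥ P i * eval (P i) (L i) = α i ∧
        ∀ h : i ∈ J, dirD (v i) (P i) (L i * linF c) = β ⟨i, h⟩ := by
      intro i
      by_cases h : i ∈ J
      · obtain ⟨c, hc1, hc2⟩ := exists_lin2 (hP0 i) (hv' i) (α i / eval (P i) (L i))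
          ((β ⟨i, h⟩ - dirD (v i) (P i) (L i) * (α i / eval (P i) (L i))) / eval (P i) (L i))
        refine ⟨c, ?_, fun _ => ?_⟩
        · rw [hc1]; field_simp [hL2 i]
        · rw [dirD_mul, dirD_linF, eval_linF, hc1, hc2, mul_div_cancel₀ _ (hL2 i)]; ring
      · obtain ⟨c, hc1, -⟩ := exists_lin2 (hP0 i) (hv' i) (α i / eval (P i) (L i)) 0
        refine ⟨c, ?_, fun h' => absurd h' h⟩
        · rw [hc1]; field_simp [hL2 i]
    choose c hc1 hc2 using hm
    refine ⟨⟨∑ i, L i * linF (c i), ?_⟩, ?_⟩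
    · apply Submodule.sum_mem
      intro i _
      have := (hL1 i).mul (linF_homog (c i))
      rw [mem_homogeneousSubmodule]
      convert this using 1
      omega
    · ext i
      · change eval (P i) (∑ j, L j * linF (c j)) = α i
        rw [map_sum, Finset.sum_eq_single i]
        · rw [map_mul, eval_linF, mul_comm, hc1]
        · intro j _ hj
          obtain ⟨F, G, h1, h2⟩ := hL3 j i hj
          rw [h1]; simp [h2]
        · simp
      · change dirD (v i) (P i) (∑ j, L j * linF (c j)) = β i
        rw [dirD_sum, Finset.sum_eq_single (i : ι)]
        · rw [hc2 i i.2]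
        · intro j _ hj
          obtain ⟨F, G, h1, h2⟩ := hL3 j i hj
          rw [h1, mul_assoc, dirD_sq _ _ _ _ h2]
        · simp
  have := bezout_dim hg hf hgp hgf Φ hΦ ?_ ?_
  · rw [Module.finrank_prod, Module.finrank_fintype_fun_eq_card,
      Module.finrank_fintype_fun_eq_card, Fintype.card_coe] at this
    exact this
  · rintro ⟨F, hF⟩ ⟨a, ha⟩
    change F = f * a at ha
    ext i
    · change eval (P i) F = 0
      rw [ha, map_mul, hfP, zero_mul]
    · change dirD (v i) (P i) F = 0
      rw [ha, dirD_mul, hv, hfP]; simp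
  · rintro ⟨F, hF⟩ ⟨a, ha⟩
    change F = g * a at ha
    ext i
    · change eval (P i) F = 0
      rw [ha, map_mul, hgP, zero_mul]
    · change dirD (v i) (P i) F = 0
      rw [ha, dirD_mul, hgP]
      simp [dirD, hJ i i.2]

end Points

end

section

open MvPolynomial


section Genus
variable {K : Type*} [Field K]

lemma eval_smul_form {σ : Type*} [Fintype σ] {p : MvPolynomial σ K} {n : ℕ} (hp : p.IsHomogeneous n) (t : K) (u : σ → K) :
    eval (t • u) p = t ^ n * eval u p := by
  rw [eval_eq', eval_eq', Finset.mul_sum]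
  apply Finset.sum_congr rfl
  intro s hs
  have h := hp.degree_eq_sum_deg_support hs
  simp only [Pi.smul_apply, smul_eq_mul, mul_pow, Finset.prod_mul_distrib]
  rw [Finset.prod_pow_eq_pow_sum, ← Finsupp.degree_eq_sum, Finsupp.degree_apply, ← h]; ring

lemma eval_line (g : MvPolynomial (Fin 3) K) (u w : Fin 3 → K) :
    ∃ r : Polynomial K, ∀ z, r.eval z = eval (u + z • w) g := by
  refine ⟨aeval (fun k => Polynomial.C (u k) + Polynomial.C (w k) * Polynomial.X) g, fun z => ?_⟩
  induction g using MvPolynomial.induction_on with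
  | C a => simp
  | add p q hp hq => simp [hp, hq]
  | mul_X p n hp => simp [hp, mul_comm (w n)]

variable [IsAlgClosed K]

lemma exists_zero_on_plane {g : MvPolynomial (Fin 3) K} {d : ℕ} (hg : g.IsHomogeneous d)
    (hd : d ≠ 0) (c : Fin 3 → K) : ∃ p : Fin 3 → K, p ≠ 0 ∧ c ⬝ᵥ p = 0 ∧ eval p g = 0 := by
  obtain ⟨w, hw, hw0⟩ := exists_ker c 0
  have hw0 : w ≠ 0 := by simpa using hw0
  obtain ⟨u, hu, hu'⟩ := exists_ker c w
  by_cases hgw : eval w g = 0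
  · exact ⟨w, hw0, hw, hgw⟩
  obtain ⟨r, hr⟩ := eval_line g u w
  by_cases hdeg : r.degree = 0
  · exfalso
    have hconst := Polynomial.eq_C_of_degree_eq_zero hdeg
    set a := r.coeff 0
    obtain ⟨r2, hr2⟩ := eval_line g w u
    have : r2 = Polynomial.X ^ d * Polynomial.C a := by
      apply Polynomial.eq_of_infinite_eval_eq
      apply Set.Infinite.mono (s := {0}ᶜ)
      · intro s hs
        have hs : s ≠ 0 := hs
        change Polynomial.eval s r2 = Polynomial.eval s _
        rw [hr2, show w + s • u = s • (u + s⁻¹ • w) by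
          rw [smul_add, smul_smul, mul_inv_cancel₀ hs, one_smul, add_comm], eval_smul_form hg,
          ← hr, hconst, Polynomial.eval_mul, Polynomial.eval_pow, Polynomial.eval_X,
          Polynomial.eval_C, Polynomial.eval_C]
      · exact (Set.finite_singleton _).infinite_compl
    have h0 := hr2 0
    rw [this] at h0
    apply hgw
    simpa [hd] using h0.symm
  · obtain ⟨z, hz⟩ := IsAlgClosed.exists_root r hdeg
    refine ⟨u + z • w, ?_, ?_, ?_⟩
    · intro h
      apply hu' (-z)
      rw [neg_smul]
      exact eq_neg_of_add_eq_zero_left h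
    · rw [dotProduct_add, dotProduct_smul, hu, hw]; simp
    · rw [← hr]; exact hz

lemma exists_new_zero {g : MvPolynomial (Fin 3) K} {d : ℕ} (hg : g.IsHomogeneous d)
    (hd : d ≠ 0) {ι : Type*} [Fintype ι] (Q : ι → Fin 3 → K) (hQ : ∀ i, Q i ≠ 0) :
    ∃ p : Fin 3 → K, p ≠ 0 ∧ eval p g = 0 ∧ ∀ i, ∀ t : K, p ≠ t • Q i ∧ Q i ≠ t • p := by
  have : Infinite K := IsAlgClosed.instInfinite
  have hprod : ∏ i, linF (Q i) ≠ 0 := by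
    rw [Finset.prod_ne_zero_iff]
    intro i _ h
    obtain ⟨r, -, hr⟩ := exists_lin (x := Q i) (y := 0) (by intro t; simpa using hQ i)
    apply hr
    rw [dotProduct_comm, ← eval_linF, h]; simp
  obtain ⟨c, hc⟩ : ∃ c, eval c (∏ i, linF (Q i)) ≠ 0 := by
    by_contra hcon
    push Not at hcon
    apply hprod
    apply MvPolynomial.funext
    intro x; rw [hcon]; simp
  rw [map_prod, Finset.prod_ne_zero_iff] at hc
  have hc : ∀ i, c ⬝ᵥ Q i ≠ 0 := by
    intro i
    rw [dotProduct_comm, ← eval_linF]; exact hc i (Finset.mem_univ i)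
  obtain ⟨p, hp0, hp1, hp2⟩ := exists_zero_on_plane hg hd c
  refine ⟨p, hp0, hp2, fun i t => ⟨fun h => ?_, fun h => ?_⟩⟩
  · rw [h, dotProduct_smul, smul_eq_mul] at hp1
    have := (mul_eq_zero.1 hp1).resolve_right (hc i)
    apply hp0; rw [h, this, zero_smul]
  · apply hc i; rw [h, dotProduct_smul, hp1, smul_zero]

/-- A family of independent zeros of `g`. -/
def IndepZeros (g : MvPolynomial (Fin 3) K) {ι : Type*} (P : ι → Fin 3 → K) : Prop :=
  (∀ i, P i ≠ 0) ∧ (∀ i j, i ≠ j → ∀ t : K, P i ≠ t • P j) ∧ ∀ i, eval (P i) g = 0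

lemma extend_zeros {g : MvPolynomial (Fin 3) K} {d : ℕ} (hg : g.IsHomogeneous d)
    (hd : d ≠ 0) {ι : Type*} [Fintype ι] (Q : ι → Fin 3 → K) (hQ : IndepZeros g Q) :
    ∃ Q' : Option ι → Fin 3 → K, IndepZeros g Q' ∧ ∀ i, Q' (some i) = Q i := by
  obtain ⟨p, hp0, hp1, hp2⟩ := exists_new_zero hg hd Q hQ.1
  refine ⟨fun o => o.elim p Q, ⟨?_, ?_, ?_⟩, fun i => rfl⟩
  · rintro (_ | i)
    · exact hp0
    · exact hQ.1 i
  · rintro (_ | i) (_ | j) hij t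
    · exact absurd rfl hij
    · exact (hp2 j t).1
    · exact (hp2 i t).2
    · exact hQ.2.1 i j (fun h => hij (by rw [h])) t
  · rintro (_ | i)
    · exact hp1
    · exact hQ.2.2 i

theorem no_eleven {g : MvPolynomial (Fin 3) K} (hg : g.IsHomogeneous 6) (hirr : Irreducible g)
    (P : Fin 11 → Fin 3 → K) (hP : IndepZeros g P)
    (hs : ∀ i k, eval (P i) (pderiv k g) = 0) : False := by
  obtain ⟨Q1, h1, e1⟩ := extend_zeros hg (by norm_num) P hP
  obtain ⟨Q2, h2, e2⟩ := extend_zeros hg (by norm_num) Q1 h1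
  obtain ⟨Q3, h3, e3⟩ := extend_zeros hg (by norm_num) Q2 h2
  let Φ : homogeneousSubmodule (Fin 3) K 4 →ₗ[K] (Option (Option (Option (Fin 11))) → K) :=
    { toFun := fun F i => eval (Q3 i) F.1
      map_add' := by intro F G; ext i; simp
      map_smul' := by intro a F; ext i; simp }
  have hker : LinearMap.ker Φ ≠ ⊥ := by
    apply LinearMap.ker_ne_bot_of_finrank_lt
    rw [finrank_forms, Module.finrank_fintype_fun_eq_card]
    simp; decide
  obtain ⟨⟨f, hf⟩, hf1, hf0⟩ := Submodule.exists_mem_ne_zero_of_ne_bot hker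
  have hf0 : f ≠ 0 := fun h => hf0 (Subtype.ext h)
  have hfQ : ∀ i, eval (Q3 i) f = 0 := fun i => congrFun hf1 i
  have hgf : ¬ g ∣ f := by
    rintro ⟨h, rfl⟩
    obtain ⟨i, j, hij, hi, hj⟩ := homog_factor hf hf0
    have := hg.inj_right hi hirr.ne_zero
    omega
  have := bezout_points hg hf hirr.prime hgf Q3 h3.1 h3.2.1 hfQ h3.2.2
    (Finset.univ.image (fun i : Fin 11 => some (some (some i)))) (by
      intro i hi k
      obtain ⟨a, -, rfl⟩ := Finset.mem_image.1 hi
      rw [e3, e2, e1]; exact hs a k)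
  rw [Finset.card_image_of_injective _ (by intro a b h; simpa using h)] at this
  simp at this

end Genus

end

section

open MvPolynomial


section Gram
open Matrix

/-- form with given coefficients -/
def formOf {d : ℕ} (c : Mon d → ℝ) : MvPolynomial (Fin 3) ℝ :=
  ∑ s : Mon d, monomial (s : Fin 3 →₀ ℕ) (c s)

/-- the vector of monomials of degree `d` -/
def mv (d : ℕ) (u : Fin 3 → ℝ) : Mon d → ℝ := fun s => eval u (monomial (s : Fin 3 →₀ ℕ) (1 : ℝ))

lemma formOf_homog {d : ℕ} (c : Mon d → ℝ) : (formOf c).IsHomogeneous d :=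
  IsHomogeneous.sum _ _ _ (fun s _ => isHomogeneous_monomial _ (mem_Mon.1 s.2))

lemma eval_formOf {d : ℕ} (c : Mon d → ℝ) (u : Fin 3 → ℝ) : eval u (formOf c) = c ⬝ᵥ mv d u := by
  simp [formOf, mv, dotProduct, eval_monomial]

lemma formOf_coeff {d : ℕ} (c : Mon d → ℝ) (t : Mon d) :
    coeff (t : Fin 3 →₀ ℕ) (formOf c) = c t := by
  rw [formOf, coeff_sum, Finset.sum_eq_single t]
  · simp
  · intro s _ hs
    rw [coeff_monomial, if_neg]
    exact fun h => hs (Subtype.ext h)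
  · simp

lemma formOf_surj {d : ℕ} {q : MvPolynomial (Fin 3) ℝ} (hq : q.IsHomogeneous d) :
    ∃ c : Mon d → ℝ, q = formOf c := by
  refine ⟨fun s => coeff (s : Fin 3 →₀ ℕ) q, ?_⟩
  conv_lhs => rw [form_eq_sum hq]
  rw [formOf, ← Finset.sum_coe_sort]

lemma mv_span {d : ℕ} (V : Submodule ℝ (Mon d → ℝ)) (hV : ∀ u, mv d u ∈ V) : V = ⊤ := by
  by_contra hne
  obtain ⟨φ, hφ0, hφ⟩ := Submodule.exists_le_ker_of_lt_top V (lt_top_iff_ne_top.2 hne)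
  apply hφ0
  let c : Mon d → ℝ := fun k => φ (fun j => if k = j then 1 else 0)
  have key : ∀ z, φ z = c ⬝ᵥ z := by
    intro z
    rw [LinearMap.pi_apply_eq_sum_univ φ z, dotProduct]
    apply Finset.sum_congr rfl
    intro i _
    rw [smul_eq_mul, mul_comm]
  have h0 : formOf c = 0 := by
    apply MvPolynomial.funext
    intro u
    rw [eval_formOf, ← key, map_zero]
    exact hφ (hV u)
  have hc : c = 0 := by
    ext t; rw [← formOf_coeff c t, h0]; simp
  refine LinearMap.ext fun z => ?_
  rw [key, hc]; simp

/-- polynomial with Gram matrix `G` -/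
def gramPoly {d : ℕ} (G : Matrix (Mon d) (Mon d) ℝ) : MvPolynomial (Fin 3) ℝ :=
  ∑ s : Mon d, ∑ t : Mon d, monomial ((s : Fin 3 →₀ ℕ) + (t : Fin 3 →₀ ℕ)) (G s t)

lemma gramPoly_homog {d : ℕ} (G : Matrix (Mon d) (Mon d) ℝ) :
    (gramPoly G).IsHomogeneous (2 * d) := by
  refine IsHomogeneous.sum _ _ _ (fun s _ => IsHomogeneous.sum _ _ _ (fun t _ => ?_))
  apply isHomogeneous_monomial
  rw [map_add, mem_Mon.1 s.2, mem_Mon.1 t.2]; ring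

lemma eval_gramPoly {d : ℕ} (G : Matrix (Mon d) (Mon d) ℝ) (u : Fin 3 → ℝ) :
    eval u (gramPoly G) = mv d u ⬝ᵥ G *ᵥ mv d u := by
  simp only [gramPoly, map_sum, dotProduct, mulVec, Finset.mul_sum]
  refine Finset.sum_congr rfl fun s _ => Finset.sum_congr rfl fun t _ => ?_
  have : monomial ((s : Fin 3 →₀ ℕ) + (t : Fin 3 →₀ ℕ)) (G s t) =
      C (G s t) * (monomial (s : Fin 3 →₀ ℕ) 1 * monomial (t : Fin 3 →₀ ℕ) 1) := by
    rw [monomial_mul, C_mul_monomial]; simp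
  rw [this]
  simp only [map_mul, eval_C, mv]
  ring

lemma quad_vecMulVec {n : Type*} [Fintype n] (c v : n → ℝ) :
    v ⬝ᵥ (vecMulVec c c) *ᵥ v = (c ⬝ᵥ v) ^ 2 := by
  rw [vecMulVec_mulVec]
  simp [dotProduct_smul, dotProduct_comm v c, sq]

theorem sos_of_step (d : ℕ)
    (H : ∀ T : MvPolynomial (Fin 3) ℝ, T.IsHomogeneous (2 * d) → Psd T → T ≠ 0 →
      ∃ q : MvPolynomial (Fin 3) ℝ, q.IsHomogeneous d ∧ q ≠ 0 ∧ Psd (T - q ^ 2))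
    (T : MvPolynomial (Fin 3) ℝ) (hT : T.IsHomogeneous (2 * d)) (hpsd : Psd T) : Sos T := by
  let S : Set (Matrix (Mon d) (Mon d) ℝ) :=
    {G | G.IsHermitian ∧ (∀ v, 0 ≤ v ⬝ᵥ G *ᵥ v) ∧ ∀ u, mv d u ⬝ᵥ G *ᵥ mv d u ≤ eval u T}
  have hcont : ∀ v : Mon d → ℝ, Continuous (fun G : Matrix (Mon d) (Mon d) ℝ => v ⬝ᵥ G *ᵥ v) := by
    intro v
    fun_prop
  have hclosed : IsClosed S := by
    have : S = {G | Gᴴ = G} ∩ ((⋂ v : Mon d → ℝ, {G | 0 ≤ v ⬝ᵥ G *ᵥ v}) ∩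
      ⋂ u : Fin 3 → ℝ, {G | mv d u ⬝ᵥ G *ᵥ mv d u ≤ eval u T}) := by
      ext G; simp [S, Matrix.IsHermitian]
    rw [this]
    refine IsClosed.inter ?_ (IsClosed.inter ?_ ?_)
    · exact isClosed_eq (by fun_prop) continuous_id
    · exact isClosed_iInter fun v => isClosed_le continuous_const (hcont v)
    · exact isClosed_iInter fun u => isClosed_le (hcont _) continuous_const
  have hbd : ∀ v : Mon d → ℝ, ∃ C, ∀ G ∈ S, v ⬝ᵥ G *ᵥ v ≤ C := by
    let V : Submodule ℝ (Mon d → ℝ) :=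
      { carrier := {v | ∃ C, ∀ G ∈ S, v ⬝ᵥ G *ᵥ v ≤ C}
        zero_mem' := ⟨0, fun G _ => by simp⟩
        add_mem' := by
          rintro a b ⟨A, hA⟩ ⟨B, hB⟩
          refine ⟨2 * A + 2 * B, fun G hG => ?_⟩
          have h1 := hA G hG
          have h2 := hB G hG
          have h3 := hG.2.1 (a - b)
          simp only [mulVec_add, mulVec_sub, add_dotProduct, sub_dotProduct, dotProduct_add,
            dotProduct_sub] at h3 ⊢
          linarith
        smul_mem' := by
          rintro r a ⟨A, hA⟩
          refine ⟨r ^ 2 * A, fun G hG => ?_⟩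
          have h1 := hA G hG
          have : (r • a) ⬝ᵥ G *ᵥ (r • a) = r ^ 2 * (a ⬝ᵥ G *ᵥ a) := by
            simp [mulVec_smul]; ring
          rw [this]
          exact mul_le_mul_of_nonneg_left h1 (sq_nonneg r) }
    have hV : V = ⊤ := mv_span V (fun u => ⟨eval u T, fun G hG => hG.2.2 u⟩)
    intro v
    have : v ∈ V := by rw [hV]; trivial
    exact this
  choose B hB using hbd
  let e : Mon d → Mon d → ℝ := fun s => Pi.single s 1
  let M : Mon d → Mon d → ℝ := fun s t => B (e s + e t) + B (e s - e t)
  have hentry : ∀ G ∈ S, ∀ s t, |G s t| ≤ M s t := by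
    intro G hG s t
    have hst : e s ⬝ᵥ G *ᵥ e t = G s t := by simp [e]
    have hts : e t ⬝ᵥ G *ᵥ e s = G s t := by
      have := congrFun (congrFun hG.1 s) t
      simp at this
      simp [e, this]
    have h1 := hB (e s + e t) G hG
    have h2 := hB (e s - e t) G hG
    have h3 := hG.2.1 (e s - e t)
    have h4 := hG.2.1 (e s + e t)
    have h5 := hG.2.1 (e s)
    have h6 := hG.2.1 (e t)
    simp only [mulVec_add, mulVec_sub, add_dotProduct, sub_dotProduct, dotProduct_add,
            dotProduct_sub, hst, hts] at h1 h2 h3 h4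
    rw [abs_le]
    constructor <;> simp only [M] <;> linarith
  have hcompact : IsCompact S := by
    have hK : IsCompact (Set.univ.pi (fun s => Set.univ.pi (fun t => Set.Icc (-M s t) (M s t))) :
        Set (Mon d → Mon d → ℝ)) :=
      isCompact_univ_pi fun s => isCompact_univ_pi fun t => isCompact_Icc
    refine IsCompact.of_isClosed_subset hK hclosed ?_
    intro G hG s _ t _
    exact abs_le.1 (hentry G hG s t)
  have hne : S.Nonempty := ⟨0, by
    refine ⟨Matrix.isHermitian_zero, ?_, ?_⟩
    · intro v; simp
    · intro u; simpa using hpsd u⟩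
  obtain ⟨G, hG, hmax⟩ := hcompact.exists_isMaxOn hne
    (f := fun G : Matrix (Mon d) (Mon d) ℝ => G.trace) (by fun_prop)
  have hTG : T = gramPoly G := by
    by_contra hcon
    obtain ⟨q, hq, hq0, hqT⟩ := H (T - gramPoly G) (hT.sub (gramPoly_homog G)) (by
      intro u
      rw [map_sub, eval_gramPoly]
      linarith [hG.2.2 u]) (sub_ne_zero.2 hcon)
    obtain ⟨c, rfl⟩ := formOf_surj hq
    have hmem : G + vecMulVec c c ∈ S := by
      refine ⟨?_, ?_, ?_⟩
      · apply hG.1.add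
        have := (posSemidef_vecMulVec_self_star c).1
        simpa using this
      · intro v
        rw [add_mulVec, dotProduct_add, quad_vecMulVec]
        have := hG.2.1 v
        positivity
      · intro u
        rw [add_mulVec, dotProduct_add, quad_vecMulVec]
        have := hqT u
        rw [map_sub, map_sub, map_pow, eval_formOf, eval_gramPoly] at this
        linarith
    have h1 : (G + vecMulVec c c).trace ≤ G.trace := hmax hmem
    rw [trace_add, trace_vecMulVec] at h1
    have h2 : c ⬝ᵥ c = 0 := by
      have : 0 ≤ c ⬝ᵥ c := Finset.sum_nonneg fun i _ => mul_self_nonneg _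
      linarith
    rw [dotProduct_self_eq_zero] at h2
    apply hq0
    simp [formOf, h2]
  have hpos : G.PosSemidef := by
    refine Matrix.PosSemidef.of_dotProduct_mulVec_nonneg hG.1 ?_
    intro x; simpa using hG.2.1 x
  obtain ⟨m, v, hv⟩ := Matrix.posSemidef_iff_eq_sum_vecMulVec.1 hpos
  refine ⟨m, fun i => formOf (v i), ?_⟩
  apply MvPolynomial.funext
  intro u
  rw [hTG, eval_gramPoly, hv, sum_mulVec, dotProduct_sum, map_sum]
  refine Finset.sum_congr rfl fun i _ => ?_
  rw [map_pow, eval_formOf, ← quad_vecMulVec]; simp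

end Gram

end

section

open MvPolynomial


section Quartic

lemma compact_lower {E : Type*} [NormedAddCommGroup E] [NormedSpace ℝ E] [FiniteDimensional ℝ E]
    [Nontrivial E] (F G : E → ℝ) (hF : Continuous F) (hG : Continuous G) (k : ℕ) (hk : k ≠ 0)
    (hFk : ∀ (t : ℝ) x, F (t • x) = t ^ k * F x) (hGk : ∀ (t : ℝ) x, G (t • x) = t ^ k * G x)
    (hpos : ∀ x, x ≠ 0 → 0 < F x) : ∃ δ : ℝ, 0 < δ ∧ ∀ x, δ * G x ≤ F x := by
  have : ProperSpace E := FiniteDimensional.proper ℝ E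
  have hS : IsCompact (Metric.sphere (0 : E) 1) := isCompact_sphere 0 1
  have hne : (Metric.sphere (0 : E) 1).Nonempty := NormedSpace.sphere_nonempty.2 zero_le_one
  obtain ⟨x0, hx0, hmin⟩ := hS.exists_isMinOn hne hF.continuousOn
  obtain ⟨x1, hx1, hmax⟩ := hS.exists_isMaxOn hne hG.continuousOn
  have hm : 0 < F x0 := hpos x0 (by rintro rfl; simp at hx0)
  refine ⟨F x0 / (|G x1| + 1), by positivity, fun x => ?_⟩
  by_cases hx : x = 0
  · subst hx
    have h1 := hFk 0 0
    have h2 := hGk 0 0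
    rw [zero_pow hk] at h1 h2
    simp at h1 h2
    simp [h1, h2]
  · have hn : 0 < ‖x‖ := norm_pos_iff.2 hx
    have hy : (‖x‖⁻¹ • x) ∈ Metric.sphere (0 : E) 1 := by
      simp [norm_smul, hn.ne']
    have e : x = ‖x‖ • (‖x‖⁻¹ • x) := by rw [smul_smul, mul_inv_cancel₀ hn.ne', one_smul]
    have h1 : F x0 ≤ F (‖x‖⁻¹ • x) := hmin hy
    have h2 : G (‖x‖⁻¹ • x) ≤ G x1 := hmax hy
    have h3 : G (‖x‖⁻¹ • x) ≤ |G x1| + 1 := by linarith [le_abs_self (G x1)]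
    have h4 : F x0 / (|G x1| + 1) * G (‖x‖⁻¹ • x) ≤ F (‖x‖⁻¹ • x) := by
      calc F x0 / (|G x1| + 1) * G (‖x‖⁻¹ • x) ≤ F x0 / (|G x1| + 1) * (|G x1| + 1) := by gcongr
        _ = F x0 := by field_simp
        _ ≤ _ := h1
    rw [e, hFk, hGk]
    have := mul_le_mul_of_nonneg_left h4 (pow_nonneg hn.le k)
    linarith

lemma lim_nonneg (φ : ℝ → ℝ) (hφ : Continuous φ) (h : ∀ t, 0 < t → 0 ≤ φ t) : 0 ≤ φ 0 := by
  have h1 : Filter.Tendsto φ (nhdsWithin 0 (Set.Ioi 0)) (nhds (φ 0)) :=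
    hφ.continuousAt.tendsto.mono_left nhdsWithin_le_nhds
  refine ge_of_tendsto h1 ?_
  filter_upwards [self_mem_nhdsWithin] with t ht using h t ht

lemma lim_zero (φ : ℝ → ℝ) (hφ : Continuous φ) (h : ∀ t, 0 ≤ t * φ t) : φ 0 = 0 := by
  apply le_antisymm
  · have := lim_nonneg (fun t => - φ (-t)) (by fun_prop) (fun t ht => by
      have := h (-t)
      have h2 : 0 ≤ t * (- φ (-t)) := by linarith
      exact nonneg_of_mul_nonneg_right h2 ht)
    simp at this; exact this
  · exact lim_nonneg φ hφ (fun t ht => nonneg_of_mul_nonneg_right (h t) ht)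

lemma quad_lin (L M : ℝ) (h : ∀ t : ℝ, 0 ≤ t * L + t ^ 2 * M) : L = 0 := by
  have := lim_zero (fun t => L + t * M) (by fun_prop) (fun t => by have := h t; linarith [this, (by ring : t * (L + t * M) = t * L + t ^ 2 * M)])
  simpa using this

lemma disc_le (A B C : ℝ) (h : ∀ x : ℝ, 0 ≤ x ^ 2 * A + 2 * x * B + C) : B ^ 2 ≤ A * C := by
  have := discrim_le_zero (a := A) (b := 2 * B) (c := C) (fun x => by have := h x; linarith)
  rw [discrim] at this; linarith

lemma lead_nonneg (A B C : ℝ) (h : ∀ x : ℝ, 0 ≤ x ^ 2 * A + 2 * x * B + C) : 0 ≤ A := by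
  have := lim_nonneg (fun t => A + 2 * t * B + t ^ 2 * C) (by fun_prop) (fun t ht => by
    have h1 := h t⁻¹
    have : A + 2 * t * B + t ^ 2 * C = t ^ 2 * (t⁻¹ ^ 2 * A + 2 * t⁻¹ * B + C) := by field_simp
    rw [this]; positivity)
  simpa using this

/-- binary forms -/
def b2 (a b c y z : ℝ) : ℝ := a * y ^ 2 + b * y * z + c * z ^ 2
/-- binary cubic -/
def b3 (a b c d y z : ℝ) : ℝ := a * y ^ 3 + b * y ^ 2 * z + c * y * z ^ 2 + d * z ^ 3
/-- binary quartic -/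
def b4 (a b c d e y z : ℝ) : ℝ :=
  a * y ^ 4 + b * y ^ 3 * z + c * y ^ 2 * z ^ 2 + d * y * z ^ 3 + e * z ^ 4

lemma b2_zero {f0 f1 f2 b c : ℝ} (hf : ∀ y z, 0 ≤ b2 f0 f1 f2 y z) (hbc : 0 < b ^ 2 + c ^ 2)
    (h0 : b2 f0 f1 f2 b c = 0) :
    ∃ ε, 0 ≤ ε ∧ ∀ y z, b2 f0 f1 f2 y z = ε * (c * y - b * z) ^ 2 := by
  have h1 : 2 * f0 * b + f1 * c = 0 := quad_lin _ f0 (fun t => by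
    have := hf (b + t) c
    unfold b2 at *; linarith)
  have h2 : 2 * f2 * c + f1 * b = 0 := quad_lin _ f2 (fun t => by
    have := hf b (c + t)
    unfold b2 at *; linarith)
  have hs : 0 ≤ f0 + f2 := by
    have h3 := hf 1 0
    have h4 := hf 0 1
    simp [b2] at h3 h4; linarith
  refine ⟨(f0 + f2) / (b ^ 2 + c ^ 2), by positivity, fun y z => ?_⟩
  unfold b2
  rw [div_mul_eq_mul_div, eq_div_iff hbc.ne']
  linear_combination (y ^ 2 * b / 2 - c * y * z * (-1) - z ^ 2 * b / 2) * h1 + (- y ^ 2 * c / 2 + b * y * z + z ^ 2 * c / 2) * h2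

lemma b2_factor {g0 g1 g2 b c : ℝ} (hbc : 0 < b ^ 2 + c ^ 2) (h0 : b2 g0 g1 g2 b c = 0) :
    ∃ m0 m1, ∀ y z, b2 g0 g1 g2 y z = (c * y - b * z) * (m0 * y + m1 * z) := by
  unfold b2 at *
  by_cases hc : c = 0
  · subst hc
    have hb : b ≠ 0 := by rintro rfl; simp at hbc
    have : g0 = 0 := by
      have : g0 * b ^ 2 = 0 := by linarith
      simpa [hb] using this
    refine ⟨-g1 / b, -g2 / b, fun y z => ?_⟩
    rw [this]; field_simp; ring
  · refine ⟨g0 / c, (g1 + b * (g0 / c)) / c, fun y z => ?_⟩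
    field_simp
    linear_combination z ^ 2 * h0

lemma b3_factor {g0 g1 g2 g3 b c : ℝ} (hbc : 0 < b ^ 2 + c ^ 2) (h0 : b3 g0 g1 g2 g3 b c = 0) :
    ∃ m0 m1 m2, ∀ y z, b3 g0 g1 g2 g3 y z = (c * y - b * z) * b2 m0 m1 m2 y z := by
  unfold b3 b2 at *
  by_cases hc : c = 0
  · subst hc
    have hb : b ≠ 0 := by rintro rfl; simp at hbc
    have : g0 = 0 := by
      have : g0 * b ^ 3 = 0 := by linarith
      simpa [hb] using this
    refine ⟨-g1 / b, -g2 / b, -g3 / b, fun y z => ?_⟩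
    rw [this]; field_simp; ring
  · refine ⟨g0 / c, (g1 + b * (g0 / c)) / c, (g2 + b * ((g1 + b * (g0 / c)) / c)) / c, fun y z => ?_⟩
    field_simp
    linear_combination z ^ 3 * h0

lemma b4_factor {g0 g1 g2 g3 g4 b c : ℝ} (hbc : 0 < b ^ 2 + c ^ 2)
    (h0 : b4 g0 g1 g2 g3 g4 b c = 0) :
    ∃ m0 m1 m2 m3, ∀ y z, b4 g0 g1 g2 g3 g4 y z = (c * y - b * z) * b3 m0 m1 m2 m3 y z := by
  unfold b4 b3 at *
  by_cases hc : c = 0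
  · subst hc
    have hb : b ≠ 0 := by rintro rfl; simp at hbc
    have : g0 = 0 := by
      have : g0 * b ^ 4 = 0 := by linarith
      simpa [hb] using this
    refine ⟨-g1 / b, -g2 / b, -g3 / b, -g4 / b, fun y z => ?_⟩
    rw [this]; field_simp; ring
  · refine ⟨g0 / c, (g1 + b * (g0 / c)) / c, (g2 + b * ((g1 + b * (g0 / c)) / c)) / c,
      (g3 + b * ((g2 + b * ((g1 + b * (g0 / c)) / c)) / c)) / c, fun y z => ?_⟩
    field_simp
    linear_combination z ^ 4 * h0

lemma off_line {b c : ℝ} (hbc : 0 < b ^ 2 + c ^ 2) (k : ℝ → ℝ → ℝ)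
    (hk : Continuous (fun p : ℝ × ℝ => k p.1 p.2))
    (h : ∀ y z, 0 ≤ (c * y - b * z) ^ 2 * k y z) (y z : ℝ) : 0 ≤ k y z := by
  by_cases hl : c * y - b * z = 0
  · have := lim_nonneg (fun t => k (y + t * c) (z - t * b))
      (hk.comp (f := fun t : ℝ => (y + t * c, z - t * b)) (by fun_prop)) (fun t ht => by
        have h1 := h (y + t * c) (z - t * b)
        have e : c * (y + t * c) - b * (z - t * b) = t * (b ^ 2 + c ^ 2) := by
          linear_combination hl
        rw [e] at h1
        exact nonneg_of_mul_nonneg_right h1 (by positivity))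
    simpa using this
  · exact nonneg_of_mul_nonneg_right (h y z) (by positivity)

lemma b2_sq {k0 k1 k2 : ℝ} (hk : ∀ y z, 0 ≤ b2 k0 k1 k2 y z) (hne : ∃ y z, b2 k0 k1 k2 y z ≠ 0) :
    ∃ m0 m1, (m0 ≠ 0 ∨ m1 ≠ 0) ∧ ∀ y z, (m0 * y + m1 * z) ^ 2 ≤ b2 k0 k1 k2 y z := by
  have h0 : 0 ≤ k0 := by have := hk 1 0; simpa [b2] using this
  have hd : (k1 / 2) ^ 2 ≤ k0 * k2 := disc_le _ _ _ (fun x => by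
    have := hk x 1
    unfold b2 at this; linarith)
  rcases h0.lt_or_eq with h0 | h0
  · obtain ⟨r, hr, rfl⟩ : ∃ r : ℝ, 0 < r ∧ k0 = r ^ 2 :=
      ⟨√k0, Real.sqrt_pos.2 h0, (Real.sq_sqrt h0.le).symm⟩
    refine ⟨r, k1 / (2 * r), Or.inl hr.ne', fun y z => ?_⟩
    have e : (r * y + k1 / (2 * r) * z) ^ 2 = r ^ 2 * y ^ 2 + k1 * y * z + k1 ^ 2 / (4 * r ^ 2) * z ^ 2 := by
      field_simp
      ring
    rw [e]; unfold b2
    have : k1 ^ 2 / (4 * r ^ 2) ≤ k2 := by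
      rw [div_le_iff₀ (by positivity)]; linarith
    have := mul_le_mul_of_nonneg_right this (sq_nonneg z)
    linarith
  · have h1 : k1 = 0 := by
      rw [← h0] at hd
      have : (k1 / 2) ^ 2 = 0 := le_antisymm (by simpa using hd) (sq_nonneg _)
      simpa using this
    have h2 : 0 ≤ k2 := by have := hk 0 1; simpa [b2] using this
    refine ⟨0, √k2, Or.inr ?_, fun y z => ?_⟩
    · intro h
      rw [Real.sqrt_eq_zero h2] at h
      obtain ⟨y, z, h3⟩ := hne
      apply h3; simp [b2, h, h1, ← h0]
    · unfold b2
      rw [← h0, h1]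
      have := Real.sq_sqrt h2
      apply le_of_eq
      linear_combination z ^ 2 * this

end Quartic

end

section

open MvPolynomial


section Quartic2

/-- ternary quadratic form -/
def q6 (a b c d e f x y z : ℝ) : ℝ :=
  a * x ^ 2 + b * x * y + c * x * z + d * y ^ 2 + e * y * z + f * z ^ 2

/-- a nonzero square of a quadratic form can be subtracted -/
def Good (T : ℝ → ℝ → ℝ → ℝ) : Prop :=
  ∃ a b c d e f, (∃ x y z, q6 a b c d e f x y z ≠ 0) ∧ ∀ x y z, (q6 a b c d e f x y z) ^ 2 ≤ T x y z

lemma pos_of_ne {y z : ℝ} (h : (y, z) ≠ (0 : ℝ × ℝ)) : 0 < y ^ 2 + z ^ 2 := by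
  by_contra hc
  apply h
  have hy : y = 0 := by nlinarith [sq_nonneg y, sq_nonneg z]
  have hz : z = 0 := by nlinarith [sq_nonneg y, sq_nonneg z]
  simp [hy, hz]

lemma quartic_binary {w0 w1 w2 w3 w4 : ℝ} (hh : ∀ y z, 0 ≤ b4 w0 w1 w2 w3 w4 y z)
    (hne : ∃ y z, b4 w0 w1 w2 w3 w4 y z ≠ 0) :
    ∃ k0 k1 k2, (∃ y z, b2 k0 k1 k2 y z ≠ 0) ∧
      ∀ y z, (b2 k0 k1 k2 y z) ^ 2 ≤ b4 w0 w1 w2 w3 w4 y z := by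
  by_cases hz : ∃ b c : ℝ, 0 < b ^ 2 + c ^ 2 ∧ b4 w0 w1 w2 w3 w4 b c = 0
  · obtain ⟨b, c, hbc, h⟩ := hz
    obtain ⟨m0, m1, m2, m3, hm⟩ := b4_factor hbc h
    have hz : b3 m0 m1 m2 m3 b c = 0 := by
      have := lim_zero (fun t => b3 m0 m1 m2 m3 (b + t * c) (c - t * b))
        (by unfold b3; fun_prop) (fun t => by
          have h1 := hh (b + t * c) (c - t * b)
          rw [hm] at h1
          have e : c * (b + t * c) - b * (c - t * b) = (b ^ 2 + c ^ 2) * t := by ring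
          rw [e, mul_assoc] at h1
          exact nonneg_of_mul_nonneg_right h1 hbc)
      simpa using this
    obtain ⟨k0, k1, k2, hk⟩ := b3_factor hbc hz
    have hkk : ∀ y z, 0 ≤ b2 k0 k1 k2 y z := off_line hbc _ (by unfold b2; fun_prop) (fun y z => by
      have := hh y z
      rw [hm, hk] at this; linarith)
    obtain ⟨n0, n1, hn, hn2⟩ := b2_sq hkk (by
      obtain ⟨y, z, h⟩ := hne
      refine ⟨y, z, fun h2 => h ?_⟩
      rw [hm, hk, h2]; simp)
    have e : ∀ y z, b2 (c * n0) (c * n1 - b * n0) (- b * n1) y z = (c * y - b * z) * (n0 * y + n1 * z) := by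
      intro y z; unfold b2; ring
    refine ⟨c * n0, c * n1 - b * n0, - b * n1, ?_, fun y z => ?_⟩
    · by_contra! hc
      have h1 : c * n0 = 0 := by simpa [b2] using hc 1 0
      have h2 : b * n1 = 0 := by simpa [b2] using hc 0 1
      have h3 : c * n1 - b * n0 = 0 := by simpa [b2, h1, h2] using hc 1 1
      have h4 : (b ^ 2 + c ^ 2) * n0 = 0 := by linear_combination c * h1 - b * h3 + c * h2
      have h5 : (b ^ 2 + c ^ 2) * n1 = 0 := by linear_combination b * h2 + c * h3 + b * h1
      rcases hn with hn | hn
      · exact hn (by simpa [hbc.ne'] using h4)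
      · exact hn (by simpa [hbc.ne'] using h5)
    · rw [e, hm, hk, mul_pow]
      have := mul_le_mul_of_nonneg_left (hn2 y z) (sq_nonneg (c * y - b * z))
      linarith
  · push Not at hz
    obtain ⟨δ, hδ, hd⟩ := compact_lower (E := ℝ × ℝ) (fun p => b4 w0 w1 w2 w3 w4 p.1 p.2)
      (fun p => (p.1 ^ 2 + p.2 ^ 2) ^ 2) (by unfold b4; fun_prop) (by fun_prop) 4 (by norm_num)
      (by intro t x; simp [b4]; ring) (by intro t x; simp; ring)
      (by
        rintro ⟨y, z⟩ hx
        exact lt_of_le_of_ne (hh y z) (hz y z (pos_of_ne hx)).symm)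
    refine ⟨√δ, 0, √δ, ⟨1, 0, by simpa [b2] using (Real.sqrt_pos.2 hδ).ne'⟩, fun y z => ?_⟩
    have := hd (y, z)
    refine le_trans (le_of_eq ?_) this
    have := Real.sq_sqrt hδ.le
    unfold b2
    linear_combination (y ^ 2 + z ^ 2) ^ 2 * this

lemma quartic_L1 {f0 f1 f2 g0 g1 g2 g3 w0 w1 w2 w3 w4 b c : ℝ}
    (hT : ∀ x y z, 0 ≤ x ^ 2 * b2 f0 f1 f2 y z + 2 * x * b3 g0 g1 g2 g3 y z + b4 w0 w1 w2 w3 w4 y z)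
    (hne : ∃ x y z, x ^ 2 * b2 f0 f1 f2 y z + 2 * x * b3 g0 g1 g2 g3 y z + b4 w0 w1 w2 w3 w4 y z ≠ 0)
    (hbc : 0 < b ^ 2 + c ^ 2) (hf0 : b2 f0 f1 f2 b c = 0) :
    Good (fun x y z => x ^ 2 * b2 f0 f1 f2 y z + 2 * x * b3 g0 g1 g2 g3 y z + b4 w0 w1 w2 w3 w4 y z) := by
  have hf : ∀ y z, 0 ≤ b2 f0 f1 f2 y z := fun y z => lead_nonneg _ _ _ (fun x => hT x y z)
  have hd : ∀ y z, (b3 g0 g1 g2 g3 y z) ^ 2 ≤ b2 f0 f1 f2 y z * b4 w0 w1 w2 w3 w4 y z :=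
    fun y z => disc_le _ _ _ (fun x => hT x y z)
  obtain ⟨ε, hε, he⟩ := b2_zero hf hbc hf0
  rcases hε.lt_or_eq with hε | hε
  · obtain ⟨m0, m1, m2, hm⟩ := b3_factor (g0 := g0) (g1 := g1) (g2 := g2) (g3 := g3) hbc (by
      have := hd b c
      rw [hf0, zero_mul] at this
      exact pow_eq_zero_iff (two_ne_zero) |>.1 (le_antisymm this (sq_nonneg _)))
    have hk : ∀ y z, 0 ≤ ε * b4 w0 w1 w2 w3 w4 y z - (b2 m0 m1 m2 y z) ^ 2 :=
      off_line hbc _ (by unfold b2 b4; fun_prop) (fun y z => by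
        have := hd y z
        rw [he, hm] at this; linarith)
    obtain ⟨r, hr, rfl⟩ : ∃ r : ℝ, 0 < r ∧ ε = r ^ 2 :=
      ⟨√ε, Real.sqrt_pos.2 hε, (Real.sq_sqrt hε.le).symm⟩
    have eQ : ∀ x y z, q6 0 (r * c) (- r * b) (m0 / r) (m1 / r) (m2 / r) x y z =
        r * x * (c * y - b * z) + b2 m0 m1 m2 y z / r := by
      intro x y z; unfold q6 b2; field_simp; ring
    refine ⟨0, r * c, - r * b, m0 / r, m1 / r, m2 / r, ?_, fun x y z => ?_⟩
    · by_contra! hc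
      have h1 := hc 1 c (-b)
      have h2 := hc 0 c (-b)
      rw [eQ] at h1 h2
      have : r * (b ^ 2 + c ^ 2) = 0 := by linear_combination h1 - h2
      simp [hr.ne', hbc.ne'] at this
    · have h1 := hk y z
      rw [eQ]
      simp only [he, hm]
      have h2 : b2 m0 m1 m2 y z ^ 2 / r ^ 2 ≤ b4 w0 w1 w2 w3 w4 y z := by
        rw [div_le_iff₀ (by positivity)]; linarith
      have e : (r * x * (c * y - b * z) + b2 m0 m1 m2 y z / r) ^ 2 =
        x ^ 2 * (r ^ 2 * (c * y - b * z) ^ 2) + 2 * x * ((c * y - b * z) * b2 m0 m1 m2 y z) +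
          b2 m0 m1 m2 y z ^ 2 / r ^ 2 := by field_simp; ring
      rw [e]; linarith
  · subst hε
    have hf : ∀ y z, b2 f0 f1 f2 y z = 0 := fun y z => by rw [he]; simp
    have hg : ∀ y z, b3 g0 g1 g2 g3 y z = 0 := fun y z => by
      have := hd y z
      rw [hf, zero_mul] at this
      exact pow_eq_zero_iff (two_ne_zero) |>.1 (le_antisymm this (sq_nonneg _))
    simp only [hf, hg, mul_zero, zero_add] at hT hne ⊢
    obtain ⟨x, hne⟩ := hne
    obtain ⟨k0, k1, k2, ⟨y, z, hk⟩, hk2⟩ := quartic_binary (hT 0) hne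
    exact ⟨0, 0, 0, k0, k1, k2, ⟨0, y, z, by simpa [q6, b2] using hk⟩, fun x y z => by
      have := hk2 y z
      simpa [q6, b2] using this⟩

lemma quartic_L2 {f0 f1 f2 g0 g1 g2 g3 w0 w1 w2 w3 w4 : ℝ}
    (hT : ∀ x y z, 0 < y ^ 2 + z ^ 2 →
      0 < x ^ 2 * b2 f0 f1 f2 y z + 2 * x * b3 g0 g1 g2 g3 y z + b4 w0 w1 w2 w3 w4 y z)
    (hf : ∀ y z, 0 < y ^ 2 + z ^ 2 → 0 < b2 f0 f1 f2 y z) :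
    Good (fun x y z => x ^ 2 * b2 f0 f1 f2 y z + 2 * x * b3 g0 g1 g2 g3 y z + b4 w0 w1 w2 w3 w4 y z) := by
  obtain ⟨δ, hδ, hd⟩ := compact_lower (E := ℝ × ℝ)
      (fun p => b2 f0 f1 f2 p.1 p.2 * b4 w0 w1 w2 w3 w4 p.1 p.2 - (b3 g0 g1 g2 g3 p.1 p.2) ^ 2)
      (fun p => (b2 f0 f1 f2 p.1 p.2) ^ 3) (by unfold b2 b3 b4; fun_prop) (by unfold b2; fun_prop)
      6 (by norm_num)
      (by intro t x; simp [b2, b3, b4]; ring) (by intro t x; simp [b2]; ring)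
      (by
        rintro ⟨y, z⟩ hx
        have hp := pos_of_ne hx
        have h1 := hf y z hp
        have h2 := hT (- b3 g0 g1 g2 g3 y z / b2 f0 f1 f2 y z) y z hp
        have h3 := mul_pos h1 h2
        have e : b2 f0 f1 f2 y z * ((- b3 g0 g1 g2 g3 y z / b2 f0 f1 f2 y z) ^ 2 * b2 f0 f1 f2 y z
          + 2 * (- b3 g0 g1 g2 g3 y z / b2 f0 f1 f2 y z) * b3 g0 g1 g2 g3 y z + b4 w0 w1 w2 w3 w4 y z) =
          b2 f0 f1 f2 y z * b4 w0 w1 w2 w3 w4 y z - (b3 g0 g1 g2 g3 y z) ^ 2 := by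
          field_simp; ring
        rw [e] at h3; exact h3)
  obtain ⟨r, hr, rfl⟩ : ∃ r : ℝ, 0 < r ∧ δ = r ^ 2 :=
      ⟨√δ, Real.sqrt_pos.2 hδ, (Real.sq_sqrt hδ.le).symm⟩
  have eQ : ∀ x y z, q6 0 0 0 (r * f0) (r * f1) (r * f2) x y z = r * b2 f0 f1 f2 y z := by
    intro x y z; unfold q6 b2; ring
  refine ⟨0, 0, 0, r * f0, r * f1, r * f2, ⟨0, 1, 0, ?_⟩, fun x y z => ?_⟩
  · rw [eQ]; exact (mul_pos hr (hf 1 0 (by norm_num))).ne'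
  · rw [eQ]
    by_cases hp : 0 < y ^ 2 + z ^ 2
    · have h1 := hf y z hp
      have h2 := hd (y, z)
      refine le_of_mul_le_mul_left ?_ h1
      simp only at h2 ⊢
      nlinarith [sq_nonneg (x * b2 f0 f1 f2 y z + b3 g0 g1 g2 g3 y z)]
    · have hy : y = 0 := by nlinarith [sq_nonneg y, sq_nonneg z]
      have hz : z = 0 := by nlinarith [sq_nonneg y, sq_nonneg z]
      simp [hy, hz, b2, b3, b4]

lemma quartic_L3 {f0 f1 f2 g0 g1 g2 w0 w1 w2 : ℝ}
    (hT : ∀ x y z, 0 ≤ x ^ 2 * b2 f0 f1 f2 y z + 2 * x * (z * b2 g0 g1 g2 y z) + z ^ 2 * b2 w0 w1 w2 y z)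
    (hf : ∀ y z, 0 < y ^ 2 + z ^ 2 → 0 < b2 f0 f1 f2 y z) :
    Good (fun x y z => x ^ 2 * b2 f0 f1 f2 y z + 2 * x * (z * b2 g0 g1 g2 y z) + z ^ 2 * b2 w0 w1 w2 y z) := by
  obtain ⟨μ, hμ, hm⟩ := compact_lower (E := ℝ × ℝ) (fun p => b2 f0 f1 f2 p.1 p.2)
      (fun p => p.1 ^ 2 + p.2 ^ 2) (by unfold b2; fun_prop) (by fun_prop)
      2 (by norm_num) (by intro t x; simp [b2]; ring) (by intro t x; simp; ring)
      (by
        rintro ⟨y, z⟩ hx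
        exact hf y z (pos_of_ne hx))
  replace hm : ∀ y z, μ * (y ^ 2 + z ^ 2) ≤ b2 f0 f1 f2 y z := fun y z => hm (y, z)
  have hdd : ∀ y z, 0 ≤ b2 f0 f1 f2 y z * b2 w0 w1 w2 y z - (b2 g0 g1 g2 y z) ^ 2 :=
    off_line (b := 1) (c := 0) (by norm_num) _ (by unfold b2; fun_prop) (fun y z => by
      have := disc_le _ _ _ (fun x => hT x y z)
      linarith)
  by_cases hz : ∃ b c : ℝ, 0 < b ^ 2 + c ^ 2 ∧ b2 f0 f1 f2 b c * b2 w0 w1 w2 b c - (b2 g0 g1 g2 b c) ^ 2 = 0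
  · obtain ⟨b, c, hbc, hz⟩ := hz
    have hfb := hf b c hbc
    obtain ⟨α, hα⟩ : ∃ α, b2 g0 g1 g2 b c + α * b2 f0 f1 f2 b c = 0 :=
      ⟨- b2 g0 g1 g2 b c / b2 f0 f1 f2 b c, by field_simp; ring⟩
    have eg : ∀ y z, b2 (g0 + α * f0) (g1 + α * f1) (g2 + α * f2) y z = b2 g0 g1 g2 y z + α * b2 f0 f1 f2 y z := by
      intro y z; unfold b2; ring
    have eh : ∀ y z, b2 (w0 + 2 * α * g0 + α ^ 2 * f0) (w1 + 2 * α * g1 + α ^ 2 * f1) (w2 + 2 * α * g2 + α ^ 2 * f2) y z = b2 w0 w1 w2 y z + 2 * α * b2 g0 g1 g2 y z + α ^ 2 * b2 f0 f1 f2 y z := by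
      intro y z; unfold b2; ring
    obtain ⟨ε, hε, he⟩ := b2_zero (f0 := w0 + 2 * α * g0 + α ^ 2 * f0) (f1 := w1 + 2 * α * g1 + α ^ 2 * f1) (f2 := w2 + 2 * α * g2 + α ^ 2 * f2) (b := b) (c := c) (fun y z => by
        rw [eh]
        by_cases hp : 0 < y ^ 2 + z ^ 2
        · refine nonneg_of_mul_nonneg_right (a := b2 f0 f1 f2 y z) ?_ (hf y z hp)
          nlinarith [hdd y z, sq_nonneg (b2 g0 g1 g2 y z + α * b2 f0 f1 f2 y z)]
        · have hy : y = 0 := by nlinarith [sq_nonneg y, sq_nonneg z]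
          have hz : z = 0 := by nlinarith [sq_nonneg y, sq_nonneg z]
          simp [hy, hz, b2]) hbc (by
        rw [eh]
        refine (mul_eq_zero.1 (?_ : b2 f0 f1 f2 b c * _ = 0)).resolve_left hfb.ne'
        linear_combination hz + (b2 g0 g1 g2 b c + α * b2 f0 f1 f2 b c) * hα)
    have hd2 : ∀ y z, (b2 g0 g1 g2 y z + α * b2 f0 f1 f2 y z) ^ 2 ≤ b2 f0 f1 f2 y z * (ε * (c * y - b * z) ^ 2) := by
      intro y z
      have := hdd y z
      rw [← he, eh]; linarith
    have eT : ∀ x y z, x ^ 2 * b2 f0 f1 f2 y z + 2 * x * (z * b2 g0 g1 g2 y z) + z ^ 2 * b2 w0 w1 w2 y z =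
        (x - α * z) ^ 2 * b2 f0 f1 f2 y z + 2 * (x - α * z) * z * (b2 g0 g1 g2 y z + α * b2 f0 f1 f2 y z)
          + z ^ 2 * (ε * (c * y - b * z) ^ 2) := by
      intro x y z
      rw [← he, eh]; ring
    rcases hε.lt_or_eq with hε | hε
    · obtain ⟨m0, m1, hmm⟩ := b2_factor (g0 := g0 + α * f0) (g1 := g1 + α * f1) (g2 := g2 + α * f2) hbc (by rw [eg, hα])
      simp only [eg] at hmm
      have hk : ∀ y z, 0 ≤ ε * b2 f0 f1 f2 y z - (m0 * y + m1 * z) ^ 2 :=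
        off_line hbc _ (by unfold b2; fun_prop) (fun y z => by
          have := hd2 y z
          rw [hmm] at this; linarith)
      obtain ⟨r, hr, rfl⟩ : ∃ r : ℝ, 0 < r ∧ ε = r ^ 2 :=
        ⟨√ε, Real.sqrt_pos.2 hε, (Real.sq_sqrt hε.le).symm⟩
      have eQ : ∀ x y z, q6 0 (m0 / r) (m1 / r) 0 (r * c - α * m0 / r) (- r * b - α * m1 / r) x y z =
          (x - α * z) * (m0 * y + m1 * z) / r + r * z * (c * y - b * z) := by
        intro x y z; unfold q6; field_simp; ring
      refine ⟨0, m0 / r, m1 / r, 0, r * c - α * m0 / r, - r * b - α * m1 / r, ?_, fun x y z => ?_⟩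
      rotate_left
      · exact (eQ x y z).symm ▸ (by
          simp only [eT, hmm]
          have h1 := hk y z
          have h2 : (m0 * y + m1 * z) ^ 2 / r ^ 2 ≤ b2 f0 f1 f2 y z := by
            rw [div_le_iff₀ (by positivity)]; linarith
          have h3 := mul_le_mul_of_nonneg_left h2 (sq_nonneg (x - α * z))
          have e : ((x - α * z) * (m0 * y + m1 * z) / r + r * z * (c * y - b * z)) ^ 2 =
            (x - α * z) ^ 2 * ((m0 * y + m1 * z) ^ 2 / r ^ 2) + 2 * (x - α * z) * z * ((c * y - b * z) * (m0 * y + m1 * z)) + z ^ 2 * (r ^ 2 * (c * y - b * z) ^ 2) := by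
            field_simp; ring
          rw [e]; linarith)
      · by_contra! hc
        have h1 := hc (α * (-b)) c (-b)
        have h2 := hc α 1 1
        have h3 := hc α 0 1
        rw [eQ] at h1 h2 h3
        have hb : b = 0 := by
          have : r * (b * (b ^ 2 + c ^ 2)) = 0 := by linear_combination -h1
          simpa [hr.ne', hbc.ne'] using this
        have hc : c = 0 := by
          have : r * c = 0 := by linear_combination h2 - h3
          simpa [hr.ne'] using this
        simp [hb, hc] at hbc
    · subst hε
      have hg : ∀ y z, b2 g0 g1 g2 y z + α * b2 f0 f1 f2 y z = 0 := fun y z => by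
        have := hd2 y z
        rw [zero_mul, mul_zero] at this
        exact pow_eq_zero_iff (two_ne_zero) |>.1 (le_antisymm this (sq_nonneg _))
      obtain ⟨r, hr, rfl⟩ : ∃ r : ℝ, 0 < r ∧ μ = r ^ 2 :=
        ⟨√μ, Real.sqrt_pos.2 hμ, (Real.sq_sqrt hμ.le).symm⟩
      have eQ : ∀ x y z, q6 0 r 0 0 (-α * r) 0 x y z = r * ((x - α * z) * y) := by
        intro x y z; unfold q6; ring
      refine ⟨0, r, 0, 0, -α * r, 0, ⟨1, 1, 0, by rw [eQ]; simpa using hr.ne'⟩, fun x y z => ?_⟩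
      rw [eQ]
      simp only [eT, hg]
      have h1 := mul_le_mul_of_nonneg_left (hm y z) (sq_nonneg (x - α * z))
      nlinarith [sq_nonneg (r * (x - α * z) * z)]
  · push Not at hz
    obtain ⟨δ, hδ, hd⟩ := compact_lower (E := ℝ × ℝ)
      (fun p => b2 f0 f1 f2 p.1 p.2 * b2 w0 w1 w2 p.1 p.2 - (b2 g0 g1 g2 p.1 p.2) ^ 2)
      (fun p => (b2 f0 f1 f2 p.1 p.2) ^ 2) (by unfold b2; fun_prop) (by unfold b2; fun_prop)
      4 (by norm_num)
      (by intro t x; simp [b2]; ring) (by intro t x; simp [b2]; ring)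
      (by
        rintro ⟨y, z⟩ hx
        exact lt_of_le_of_ne (hdd y z) (hz y z (pos_of_ne hx)).symm)
    have hδμ : 0 < δ * μ := mul_pos hδ hμ
    obtain ⟨r, hr, hr2⟩ : ∃ r : ℝ, 0 < r ∧ δ * μ = r ^ 2 :=
      ⟨√(δ * μ), Real.sqrt_pos.2 hδμ, (Real.sq_sqrt hδμ.le).symm⟩
    refine ⟨0, 0, 0, 0, 0, r, ⟨0, 0, 1, by simpa [q6] using hr.ne'⟩, fun x y z => ?_⟩
    have eQ : q6 0 0 0 0 0 r x y z = r * z ^ 2 := by unfold q6; ring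
    rw [eQ, mul_pow, ← hr2]
    by_cases hp : 0 < y ^ 2 + z ^ 2
    · have h1 := hf y z hp
      have h2 := hd (y, z)
      have h3 := mul_le_mul_of_nonneg_left (hm y z) (show 0 ≤ δ * z ^ 2 by positivity)
      have h4 : 0 ≤ δ * z ^ 2 * (μ * y ^ 2) := by positivity
      have h5 : δ * z ^ 2 * b2 f0 f1 f2 y z ≤ x ^ 2 * b2 f0 f1 f2 y z + 2 * x * (z * b2 g0 g1 g2 y z) + z ^ 2 * b2 w0 w1 w2 y z := by
        refine le_of_mul_le_mul_left ?_ h1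
        simp only at h2 ⊢
        have := mul_le_mul_of_nonneg_left h2 (sq_nonneg z)
        nlinarith [sq_nonneg (x * b2 f0 f1 f2 y z + z * b2 g0 g1 g2 y z)]
      simp only
      nlinarith
    · have hy : y = 0 := by nlinarith [sq_nonneg y, sq_nonneg z]
      have hz : z = 0 := by nlinarith [sq_nonneg y, sq_nonneg z]
      simp [hy, hz, b2]

end Quartic2

end

section

open MvPolynomial


section Expand

lemma eval_tuple {n : ℕ} {p : MvPolynomial (Fin 3) ℝ} (hp : p.IsHomogeneous n) (u : Fin 3 → ℝ) :
    eval u p = ∑ t ∈ Finset.Nat.antidiagonalTuple 3 n,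
      coeff (Finsupp.equivFunOnFinite.symm t) p * (u 0 ^ t 0 * u 1 ^ t 1 * u 2 ^ t 2) := by
  conv_lhs => rw [form_eq_sum hp]
  rw [map_sum]
  refine Finset.sum_bij' (fun s _ => Finsupp.equivFunOnFinite s)
    (fun t _ => Finsupp.equivFunOnFinite.symm t) ?_ ?_ ?_ ?_ ?_
  · intro s hs
    rw [Finset.Nat.mem_antidiagonalTuple]
    rw [mem_Mon, Finsupp.degree_eq_sum] at hs
    simpa using hs
  · intro t ht
    rw [Finset.Nat.mem_antidiagonalTuple] at ht
    rw [mem_Mon, Finsupp.degree_eq_sum]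
    simpa using ht
  · intro s hs; simp
  · intro t ht; simp
  · intro s hs
    rw [eval_monomial, Finsupp.prod_fintype _ _ (by simp)]
    simp [Fin.prod_univ_three]

lemma expand4 {p : MvPolynomial (Fin 3) ℝ} (hp : p.IsHomogeneous 4) :
    ∃ c400 c310 c301 c220 c211 c202 c130 c121 c112 c103 c040 c031 c022 c013 c004 : ℝ,
    ∀ x y z : ℝ, eval ![x, y, z] p = c400 * x ^ 4 + x ^ 3 * (c310 * y + c301 * z)
      + x ^ 2 * b2 c220 c211 c202 y z + 2 * x * b3 c130 c121 c112 c103 y z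
      + b4 c040 c031 c022 c013 c004 y z := by
  have e : Finset.Nat.antidiagonalTuple 3 4 = {![4,0,0], ![3,1,0], ![3,0,1], ![2,2,0], ![2,1,1],
    ![2,0,2], ![1,3,0], ![1,2,1], ![1,1,2], ![1,0,3], ![0,4,0], ![0,3,1], ![0,2,2], ![0,1,3], ![0,0,4]} := by
    decide
  set c : (Fin 3 → ℕ) → ℝ := fun t => coeff (Finsupp.equivFunOnFinite.symm t) p with hc
  refine ⟨c ![4,0,0], c ![3,1,0], c ![3,0,1], c ![2,2,0], c ![2,1,1], c ![2,0,2], c ![1,3,0] / 2,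
    c ![1,2,1] / 2, c ![1,1,2] / 2, c ![1,0,3] / 2, c ![0,4,0], c ![0,3,1], c ![0,2,2], c ![0,1,3],
    c ![0,0,4], fun x y z => ?_⟩
  rw [eval_tuple hp, e]
  repeat rw [Finset.sum_insert (by decide)]
  rw [Finset.sum_singleton]
  change c _ * _ + (c _ * _ + (c _ * _ + (c _ * _ + (c _ * _ + (c _ * _ + (c _ * _ + (c _ * _ + (c _ * _ + (c _ * _ + (c _ * _ + (c _ * _ + (c _ * _ + (c _ * _ + c _ * _))))))))))))) = _
  simp only [Matrix.cons_val]
  unfold b2 b3 b4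
  ring

end Expand

section Reduce

lemma good_of_zero {c400 c310 c301 c220 c211 c202 c130 c121 c112 c103 c040 c031 c022 c013 c004 : ℝ}
    (F : ℝ → ℝ → ℝ → ℝ)
    (hF : ∀ x y z : ℝ, F x y z = c400 * x ^ 4 + x ^ 3 * (c310 * y + c301 * z)
      + x ^ 2 * b2 c220 c211 c202 y z + 2 * x * b3 c130 c121 c112 c103 y z
      + b4 c040 c031 c022 c013 c004 y z)
    (hpos : ∀ x y z, 0 ≤ F x y z) (hne : ∃ x y z, F x y z ≠ 0) (h0 : F 1 0 0 = 0)
    (h1 : F 0 1 0 = 0 ∨ ∀ x y z, 0 < y ^ 2 + z ^ 2 → F x y z ≠ 0) : Good F := by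
  have e4 : c400 = 0 := by rw [hF] at h0; simpa [b2, b3, b4] using h0
  have e31 : c310 = 0 := by
    have := lim_zero (fun t => c310 + t * c220 + 2 * t ^ 2 * c130 + t ^ 3 * c040) (by fun_prop) (fun t => by
      have := hpos 1 t 0
      rw [hF, e4] at this
      refine this.trans_eq ?_
      unfold b2 b3 b4; ring)
    simpa using this
  have e30 : c301 = 0 := by
    have := lim_zero (fun t => c301 + t * c202 + 2 * t ^ 2 * c103 + t ^ 3 * c004) (by fun_prop) (fun t => by
      have := hpos 1 0 t
      rw [hF, e4] at this
      refine this.trans_eq ?_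
      unfold b2 b3 b4; ring)
    simpa using this
  have hF' : F = fun x y z => x ^ 2 * b2 c220 c211 c202 y z + 2 * x * b3 c130 c121 c112 c103 y z
      + b4 c040 c031 c022 c013 c004 y z := by
    funext x y z; rw [hF, e4, e31, e30]; ring
  by_cases hz : ∃ b c : ℝ, 0 < b ^ 2 + c ^ 2 ∧ b2 c220 c211 c202 b c = 0
  · obtain ⟨b, c, hbc, hz⟩ := hz
    subst hF'
    exact quartic_L1 hpos hne hbc hz
  · push Not at hz
    have hf : ∀ y z, 0 < y ^ 2 + z ^ 2 → 0 < b2 c220 c211 c202 y z := by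
      intro y z h
      refine lt_of_le_of_ne (lead_nonneg _ (b3 c130 c121 c112 c103 y z)
        (b4 c040 c031 c022 c013 c004 y z) (fun x => ?_)) (hz y z h).symm
      have := hpos x y z
      rw [hF'] at this; exact this
    rcases h1 with h1 | h1
    · have e04 : c040 = 0 := by rw [hF] at h1; simpa [b2, b3, b4] using h1
      have e13 : c130 = 0 := by
        have := lim_zero (fun t => 2 * c130 + t * c220) (by fun_prop) (fun t => by
          have := hpos t 1 0
          rw [hF, e4, e31, e04] at this
          refine this.trans_eq ?_
          unfold b2 b3 b4; ring)
        simpa using this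
      have e03 : c031 = 0 := by
        have := lim_zero (fun t => c031 + t * c022 + t ^ 2 * c013 + t ^ 3 * c004) (by fun_prop) (fun t => by
          have := hpos 0 1 t
          rw [hF, e4, e04] at this
          refine this.trans_eq ?_
          unfold b2 b3 b4; ring)
        simpa using this
      have hF2 : F = fun x y z => x ^ 2 * b2 c220 c211 c202 y z + 2 * x * (z * b2 c121 c112 c103 y z)
          + z ^ 2 * b2 c022 c013 c004 y z := by
        rw [hF', e13, e04, e03]
        funext x y z; unfold b2 b3 b4; ring
      subst hF2
      exact quartic_L3 hpos hf
    · subst hF'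
      exact quartic_L2 (fun x y z h => lt_of_le_of_ne (hpos x y z) (h1 x y z h).symm) hf

end Reduce

end

section

open MvPolynomial Matrix


section HilbertQuartic

lemma vec3_eta (p : Fin 3 → ℝ) : ![p 0, p 1, p 2] = p := by
  ext i; fin_cases i <;> rfl

lemma exists_basis {u v : Fin 3 → ℝ} (hu : u ≠ 0) (hv : ∀ t : ℝ, v ≠ t • u) :
    ∃ M : Matrix (Fin 3) (Fin 3) ℝ, IsUnit M.det ∧ M *ᵥ ![1, 0, 0] = u ∧ M *ᵥ ![0, 1, 0] = v := by
  have hli : LinearIndependent ℝ ![u, v] := by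
    rw [LinearIndependent.pair_iff' hu]
    intro a h; exact hv a h.symm
  have hw := crossProduct_ne_zero_iff_linearIndependent.2 hli
  set w := crossProduct u v with hwd
  refine ⟨(Matrix.of ![u, v, w])ᵀ, ?_, ?_, ?_⟩
  · rw [Matrix.det_transpose, isUnit_iff_ne_zero]
    have h1 : Matrix.det (Matrix.of ![u, v, w]) = w ⬝ᵥ w := by
      have := triple_product_eq_det u v w
      rw [triple_product_permutation, triple_product_permutation, ← hwd] at this
      exact this.symm
    rw [h1]
    intro h
    exact hw (dotProduct_self_eq_zero.1 h)
  · ext i; simp [Matrix.mulVec, dotProduct, Fin.sum_univ_three]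
  · ext i; simp [Matrix.mulVec, dotProduct, Fin.sum_univ_three]

/-- linear change of coordinates -/
def chg (M : Matrix (Fin 3) (Fin 3) ℝ) (T : MvPolynomial (Fin 3) ℝ) : MvPolynomial (Fin 3) ℝ :=
  aeval (fun k => linF (fun j => M k j)) T

lemma chg_homog (M : Matrix (Fin 3) (Fin 3) ℝ) {T : MvPolynomial (Fin 3) ℝ} {n : ℕ}
    (hT : T.IsHomogeneous n) : (chg M T).IsHomogeneous n := by
  have := hT.aeval (fun k => linF (fun j => M k j)) (n := 1) (fun k => linF_homog (fun j => M k j))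
  rwa [one_mul] at this

lemma eval_chg (M : Matrix (Fin 3) (Fin 3) ℝ) (T : MvPolynomial (Fin 3) ℝ) (p : Fin 3 → ℝ) :
    eval p (chg M T) = eval (M *ᵥ p) T := by
  unfold chg
  induction T using MvPolynomial.induction_on with
  | C a => simp
  | add p q hp hq => rw [map_add, map_add, hp, hq, map_add]
  | mul_X q k hq => 
    rw [map_mul, map_mul, hq, aeval_X, eval_linF, map_mul, eval_X]; rfl

/-- polynomial version of `q6` -/
def q6p (a b c d e f : ℝ) : MvPolynomial (Fin 3) ℝ :=
  C a * (X 0 * X 0) + C b * (X 0 * X 1) + C c * (X 0 * X 2) + C d * (X 1 * X 1) + C e * (X 1 * X 2)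
    + C f * (X 2 * X 2)

lemma q6p_homog (a b c d e f : ℝ) : (q6p a b c d e f).IsHomogeneous 2 := by
  have h : ∀ (r : ℝ) (i j : Fin 3), (C r * (X i * X j) : MvPolynomial (Fin 3) ℝ).IsHomogeneous 2 :=
    fun r i j => by
      have := (isHomogeneous_C (Fin 3) r).mul ((isHomogeneous_X ℝ i).mul (isHomogeneous_X ℝ j))
      simpa using this
  unfold q6p
  exact ((((((h a 0 0).add (h b 0 1)).add (h c 0 2)).add (h d 1 1)).add (h e 1 2)).add (h f 2 2))

lemma eval_q6p (a b c d e f : ℝ) (p : Fin 3 → ℝ) :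
    eval p (q6p a b c d e f) = q6 a b c d e f (p 0) (p 1) (p 2) := by
  simp [q6p, q6]; ring

lemma exists_eval_ne {T : MvPolynomial (Fin 3) ℝ} (h : T ≠ 0) : ∃ p, eval p T ≠ 0 := by
  by_contra! hc
  exact h (MvPolynomial.funext (fun p => by simpa using hc p))

theorem quartic_step (T : MvPolynomial (Fin 3) ℝ) (hT : T.IsHomogeneous 4) (hpsd : Psd T)
    (h0 : T ≠ 0) : ∃ q : MvPolynomial (Fin 3) ℝ, q.IsHomogeneous 2 ∧ q ≠ 0 ∧ Psd (T - q ^ 2) := by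
  by_cases hz : ∃ u : Fin 3 → ℝ, u ≠ 0 ∧ eval u T = 0
  · obtain ⟨u, hu, hu0⟩ := hz
    obtain ⟨v, hv, hv2⟩ : ∃ v : Fin 3 → ℝ, (∀ t : ℝ, v ≠ t • u) ∧
        (eval v T = 0 ∨ ∀ p : Fin 3 → ℝ, (∀ t : ℝ, p ≠ t • u) → eval p T ≠ 0) := by
      by_cases h : ∃ v : Fin 3 → ℝ, (∀ t : ℝ, v ≠ t • u) ∧ eval v T = 0
      · obtain ⟨v, h1, h2⟩ := h
        exact ⟨v, h1, Or.inl h2⟩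
      · push Not at h
        obtain ⟨v, _, hv⟩ := exists_ker 0 u
        exact ⟨v, hv, Or.inr h⟩
    obtain ⟨M, hM, hM0, hM1⟩ := exists_basis hu hv
    obtain ⟨c400, c310, c301, c220, c211, c202, c130, c121, c112, c103, c040, c031, c022, c013, c004, hF⟩ :=
      expand4 (chg_homog M hT)
    have hgood := good_of_zero (fun x y z => eval ![x, y, z] (chg M T)) hF
      (fun x y z => by rw [eval_chg]; exact hpsd _)
      (by
        obtain ⟨p, hp⟩ := exists_eval_ne h0
        refine ⟨(M⁻¹ *ᵥ p) 0, (M⁻¹ *ᵥ p) 1, (M⁻¹ *ᵥ p) 2, ?_⟩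
        rw [vec3_eta, eval_chg, Matrix.mulVec_mulVec, Matrix.mul_nonsing_inv _ hM, Matrix.one_mulVec]
        exact hp)
      (by rw [eval_chg, hM0, hu0])
      (by
        rcases hv2 with h | h
        · left; rw [eval_chg, hM1, h]
        · right
          intro x y z hyz
          rw [eval_chg]
          apply h
          intro t ht
          have e : M *ᵥ ![x, y, z] = M *ᵥ (t • ![1, 0, 0]) := by rw [ht, Matrix.mulVec_smul, hM0]
          have e2 := congrArg (fun p => M⁻¹ *ᵥ p) e
          simp only [Matrix.mulVec_mulVec, Matrix.nonsing_inv_mul _ hM, Matrix.one_mulVec] at e2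
          have ey := congrFun e2 1
          have ez := congrFun e2 2
          simp at ey ez
          simp [ey, ez] at hyz)
    obtain ⟨a, b, c, d, e, f, ⟨x, y, z, hne⟩, hle⟩ := hgood
    refine ⟨chg M⁻¹ (q6p a b c d e f), chg_homog _ (q6p_homog _ _ _ _ _ _), ?_, ?_⟩
    · intro h
      apply hne
      have := congrArg (eval (M *ᵥ ![x, y, z])) h
      rw [eval_chg, Matrix.mulVec_mulVec, Matrix.nonsing_inv_mul _ hM, Matrix.one_mulVec, eval_q6p] at this
      simpa using this
    · intro p
      have := hle ((M⁻¹ *ᵥ p) 0) ((M⁻¹ *ᵥ p) 1) ((M⁻¹ *ᵥ p) 2)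
      simp only [vec3_eta] at this
      rw [eval_chg, Matrix.mulVec_mulVec, Matrix.mul_nonsing_inv _ hM, Matrix.one_mulVec] at this
      simp only [map_sub, map_pow, eval_chg, eval_q6p]
      linarith
  · push Not at hz
    obtain ⟨δ, hδ, hd⟩ := compact_lower (E := Fin 3 → ℝ) (fun p => eval p T)
      (fun p => (p 0 ^ 2 + p 1 ^ 2 + p 2 ^ 2) ^ 2) (MvPolynomial.continuous_eval T) (by fun_prop) 4
      (by norm_num) (fun t x => eval_smul_form hT t x) (by intro t x; simp; ring)
      (fun x hx => lt_of_le_of_ne (hpsd x) (hz x hx).symm)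
    obtain ⟨r, hr, rfl⟩ : ∃ r : ℝ, 0 < r ∧ δ = r ^ 2 :=
      ⟨√δ, Real.sqrt_pos.2 hδ, (Real.sq_sqrt hδ.le).symm⟩
    refine ⟨q6p r 0 0 r 0 r, q6p_homog _ _ _ _ _ _, ?_, fun p => ?_⟩
    · intro h
      have := congrArg (eval ![1, 0, 0]) h
      rw [eval_q6p] at this
      simp [q6] at this
      exact hr.ne' this
    · have := hd p
      simp only [map_sub, map_pow, eval_q6p]
      unfold q6
      linarith

lemma expand2 {p : MvPolynomial (Fin 3) ℝ} (hp : p.IsHomogeneous 2) :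
    ∃ a b c d e f : ℝ, ∀ u : Fin 3 → ℝ, eval u p = q6 a b c d e f (u 0) (u 1) (u 2) := by
  have e : Finset.Nat.antidiagonalTuple 3 2 = {![2,0,0], ![1,1,0], ![1,0,1], ![0,2,0], ![0,1,1],
    ![0,0,2]} := by decide
  set c : (Fin 3 → ℕ) → ℝ := fun t => coeff (Finsupp.equivFunOnFinite.symm t) p with hc
  refine ⟨c ![2,0,0], c ![1,1,0], c ![1,0,1], c ![0,2,0], c ![0,1,1], c ![0,0,2], fun u => ?_⟩
  rw [eval_tuple hp, e]
  repeat rw [Finset.sum_insert (by decide)]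
  rw [Finset.sum_singleton]
  change c _ * _ + (c _ * _ + (c _ * _ + (c _ * _ + (c _ * _ + c _ * _)))) = _
  simp only [Matrix.cons_val]
  unfold q6
  ring

theorem quadratic_step (T : MvPolynomial (Fin 3) ℝ) (hT : T.IsHomogeneous 2) (hpsd : Psd T)
    (h0 : T ≠ 0) : ∃ q : MvPolynomial (Fin 3) ℝ, q.IsHomogeneous 1 ∧ q ≠ 0 ∧ Psd (T - q ^ 2) := by
  obtain ⟨a, b, c, d, e, f, hF⟩ := expand2 hT
  obtain ⟨u, hu⟩ := exists_eval_ne h0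
  have hpos : 0 < eval u T := lt_of_le_of_ne (hpsd u) hu.symm
  obtain ⟨r, hr, hr2⟩ : ∃ r : ℝ, 0 < r ∧ eval u T = r ^ 2 :=
      ⟨√(eval u T), Real.sqrt_pos.2 hpos, (Real.sq_sqrt hpos.le).symm⟩
  set w : Fin 3 → ℝ := ![a * u 0 + b / 2 * u 1 + c / 2 * u 2, b / 2 * u 0 + d * u 1 + e / 2 * u 2,
    c / 2 * u 0 + e / 2 * u 1 + f * u 2] with hw
  have hwu : w ⬝ᵥ u = eval u T := by
    rw [hF]; simp [hw, dotProduct, Fin.sum_univ_three, q6]; ring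
  refine ⟨linF (r⁻¹ • w), linF_homog _, ?_, fun p => ?_⟩
  · intro h
    have := congrArg (eval u) h
    rw [eval_linF, smul_dotProduct, hwu, hr2] at this
    simp [hr.ne'] at this
  · have h1 : (w ⬝ᵥ p) ^ 2 ≤ eval u T * eval p T := disc_le _ _ _ (fun x => by
      have := hpsd (x • u + p)
      refine this.trans_eq ?_
      rw [hF, hF, hF]; simp [hw, dotProduct, Fin.sum_univ_three, q6]; ring)
    simp only [map_sub, map_pow, eval_linF, smul_dotProduct, smul_eq_mul]
    rw [hr2] at h1
    have h2 : (r⁻¹ * w ⬝ᵥ p) ^ 2 ≤ eval p T := by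
      rw [mul_pow, inv_pow, inv_mul_le_iff₀ (by positivity)]; exact h1
    linarith

theorem sos4 {T : MvPolynomial (Fin 3) ℝ} (hT : T.IsHomogeneous 4) (hpsd : Psd T) : Sos T :=
  sos_of_step 2 (fun T h1 h2 h3 => quartic_step T h1 h2 h3) T hT hpsd

theorem sos2 {T : MvPolynomial (Fin 3) ℝ} (hT : T.IsHomogeneous 2) (hpsd : Psd T) : Sos T :=
  sos_of_step 1 (fun T h1 h2 h3 => quadratic_step T h1 h2 h3) T hT hpsd

lemma sos_sq (p : MvPolynomial (Fin 3) ℝ) : Sos (p ^ 2) := ⟨1, fun _ => p, by simp⟩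

lemma sos_fintype {ι : Type*} [Fintype ι] (h : ι → MvPolynomial (Fin 3) ℝ) : Sos (∑ i, h i ^ 2) := by
  refine ⟨Fintype.card ι, fun i => h ((Fintype.equivFin ι).symm i), ?_⟩
  exact (Equiv.sum_comp (Fintype.equivFin ι).symm (fun i => h i ^ 2)).symm

lemma Sos.mul {p q : MvPolynomial (Fin 3) ℝ} (hp : Sos p) (hq : Sos q) : Sos (p * q) := by
  obtain ⟨n, f, rfl⟩ := hp
  obtain ⟨m, g, rfl⟩ := hq
  have := sos_fintype (fun x : Fin n × Fin m => f x.1 * g x.2)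
  rw [Fintype.sum_prod_type] at this
  simpa [Finset.sum_mul_sum, mul_pow] using this

lemma Sos.add {p q : MvPolynomial (Fin 3) ℝ} (hp : Sos p) (hq : Sos q) : Sos (p + q) := by
  obtain ⟨n, f, rfl⟩ := hp
  obtain ⟨m, g, rfl⟩ := hq
  have := sos_fintype (Sum.elim f g)
  rw [Fintype.sum_sum_type] at this
  simpa using this

theorem sos0 {T : MvPolynomial (Fin 3) ℝ} (hT : T.IsHomogeneous 0) (hpsd : Psd T) : Sos T := by
  obtain ⟨c, rfl⟩ : ∃ c, T = C c := ⟨_, totalDegree_eq_zero_iff_eq_C.1 ((totalDegree_zero_iff_isHomogeneous _).2 hT)⟩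
  have : 0 ≤ c := by simpa using hpsd 0
  have h := sos_sq (C √c)
  rwa [← C_pow, Real.sq_sqrt this] at h

end HilbertQuartic

end

section

open MvPolynomial Matrix


section RealFactor

lemma taylor1 (g : MvPolynomial (Fin 3) ℝ) (u : Fin 3 → ℝ) (k : Fin 3) :
    ∃ R : ℝ → ℝ, Continuous R ∧ ∀ t : ℝ, eval (u + t • Pi.single k (1 : ℝ)) g =
      eval u g + t * eval u (pderiv k g) + t ^ 2 * R t := by
  induction g using MvPolynomial.induction_on with
  | C a => exact ⟨fun _ => 0, continuous_const, fun t => by simp⟩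
  | add p q hp hq =>
    obtain ⟨R, hR, h1⟩ := hp
    obtain ⟨S, hS, h2⟩ := hq
    refine ⟨fun t => R t + S t, hR.add hS, fun t => ?_⟩
    rw [map_add, h1, h2]; simp only [map_add]; ring
  | mul_X p j hp =>
    obtain ⟨R, hR, h1⟩ := hp
    obtain ⟨δ, hδ⟩ : ∃ δ : ℝ, δ = Pi.single (M := fun _ => ℝ) k 1 j := ⟨_, rfl⟩
    refine ⟨fun t => R t * u j + eval u (pderiv k p) * δ + t * (R t * δ), by fun_prop, fun t => ?_⟩
    have e : eval u (pderiv k (X j : MvPolynomial (Fin 3) ℝ)) = δ := by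
      rw [hδ, pderiv_X]
      by_cases h : j = k
      · subst h; simp
      · simp [Pi.single_apply, h]
    rw [map_mul, h1, eval_X, Derivation.leibniz]
    simp only [Pi.add_apply, Pi.smul_apply, smul_eq_mul, map_add, map_mul, e, eval_X, ← hδ]
    ring

lemma psd_crit {g : MvPolynomial (Fin 3) ℝ} (hg : Psd g) {u : Fin 3 → ℝ} (hu : eval u g = 0)
    (k : Fin 3) : eval u (pderiv k g) = 0 := by
  obtain ⟨R, hR, h1⟩ := taylor1 g u k
  have := lim_zero (fun t => eval u (pderiv k g) + t * R t) (by fun_prop) (fun t => by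
    have := hg (u + t • Pi.single k (1 : ℝ))
    rw [h1, hu] at this
    refine this.trans_eq ?_
    ring)
  simpa using this

lemma dense_nonneg {a q : MvPolynomial (Fin 3) ℝ} (ha : a ≠ 0)
    (h : ∀ p, eval p a ≠ 0 → 0 ≤ eval p q) : Psd q := by
  intro p
  by_contra! hp
  obtain ⟨p0, hp0⟩ := exists_eval_ne ha
  obtain ⟨r, hr⟩ := eval_line a p (p0 - p)
  have hr0 : r ≠ 0 := by
    rintro rfl
    have := hr 1
    simp at this
    exact hp0 this.symm
  have hcont : Continuous (fun t : ℝ => eval (p + t • (p0 - p)) q) :=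
    (MvPolynomial.continuous_eval q).comp (by fun_prop)
  have hnb : {t : ℝ | eval (p + t • (p0 - p)) q < 0} ∈ nhds (0 : ℝ) :=
    (isOpen_lt hcont continuous_const).mem_nhds (by simpa using hp)
  refine (infinite_of_mem_nhds 0 hnb) ((Polynomial.finite_setOf_isRoot hr0).subset ?_)
  intro t ht
  change r.eval t = 0
  rw [hr]
  by_contra hc
  exact absurd (h _ hc) (not_le.2 ht)

/-- takes both signs -/
def Indef (a : MvPolynomial (Fin 3) ℝ) : Prop := (∃ u, eval u a < 0) ∧ ∃ v, 0 < eval v a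

lemma many_zeros {a : MvPolynomial (Fin 3) ℝ} {n : ℕ} (hn : n ≠ 0) (ha : a.IsHomogeneous n)
    (hi : Indef a) (N : ℕ) : ∃ P : Fin N → Fin 3 → ℝ, (∀ i, P i ≠ 0) ∧
      (∀ i j, i ≠ j → ∀ t : ℝ, P i ≠ t • P j) ∧ ∀ i, eval (P i) a = 0 := by
  obtain ⟨⟨u, hu⟩, v0, hv0⟩ := hi
  have hu0 : u ≠ 0 := by
    rintro rfl
    have := eval_smul_form ha 0 (0 : Fin 3 → ℝ)
    rw [zero_pow hn, zero_mul, smul_zero] at this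
    rw [this] at hu; exact lt_irrefl _ hu
  obtain ⟨v, hv, hvu⟩ : ∃ v, 0 < eval v a ∧ ∀ t : ℝ, v ≠ t • u := by
    by_cases h : ∀ t : ℝ, v0 ≠ t • u
    · exact ⟨v0, hv0, h⟩
    · push Not at h
      obtain ⟨t, ht⟩ := h
      obtain ⟨w, _, hw⟩ := exists_ker 0 u
      have hcont : Continuous (fun s : ℝ => eval (v0 + s • w) a) :=
        (MvPolynomial.continuous_eval a).comp (by fun_prop)
      have hnb : {s : ℝ | 0 < eval (v0 + s • w) a} ∈ nhds (0 : ℝ) :=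
        (isOpen_lt continuous_const hcont).mem_nhds (by simpa using hv0)
      obtain ⟨s, hs, hs0⟩ := ((infinite_of_mem_nhds 0 hnb).diff (Set.finite_singleton (0:ℝ))).nonempty
      refine ⟨v0 + s • w, hs, fun t' h => ?_⟩
      have hs0 : s ≠ 0 := hs0
      apply hw (s⁻¹ * (t' - t))
      have : s • w = (t' - t) • u := by rw [sub_smul, ← h, ht]; simp
      rw [mul_smul, ← this, smul_smul, inv_mul_cancel₀ hs0, one_smul]
  obtain ⟨M, hM, hM0, hM1⟩ := exists_basis hu0 hvu
  have hc1 : Continuous (fun t : ℝ => eval (M *ᵥ ![1, 0, t]) a) :=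
    (MvPolynomial.continuous_eval a).comp
      (Continuous.matrix_mulVec continuous_const (by
        refine continuous_pi (fun i => ?_); fin_cases i <;> simp <;> fun_prop))
  have hc2 : Continuous (fun t : ℝ => eval (M *ᵥ ![0, 1, t]) a) :=
    (MvPolynomial.continuous_eval a).comp
      (Continuous.matrix_mulVec continuous_const (by
        refine continuous_pi (fun i => ?_); fin_cases i <;> simp <;> fun_prop))
  have hnb : {t : ℝ | eval (M *ᵥ ![1, 0, t]) a < 0 ∧ 0 < eval (M *ᵥ ![0, 1, t]) a} ∈ nhds (0 : ℝ) :=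
    Filter.inter_mem ((isOpen_lt hc1 continuous_const).mem_nhds (by simpa [hM0] using hu))
      ((isOpen_lt continuous_const hc2).mem_nhds (by simpa [hM1] using hv))
  have hinf := infinite_of_mem_nhds 0 hnb
  have hz : ∀ t ∈ {t : ℝ | eval (M *ᵥ ![1, 0, t]) a < 0 ∧ 0 < eval (M *ᵥ ![0, 1, t]) a},
      ∃ s : ℝ, eval (M *ᵥ ![1 - s, s, t]) a = 0 := by
    rintro t ⟨h1, h2⟩
    have hc : Continuous (fun s : ℝ => eval (M *ᵥ ![1 - s, s, t]) a) :=
      (MvPolynomial.continuous_eval a).comp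
        (Continuous.matrix_mulVec continuous_const (by
          refine continuous_pi (fun i => ?_); fin_cases i <;> simp <;> fun_prop))
    have := intermediate_value_Icc (zero_le_one' ℝ) hc.continuousOn
    obtain ⟨s, _, hs⟩ := this (show (0 : ℝ) ∈ _ by
      simp only [sub_zero, sub_self]; exact ⟨h1.le, h2.le⟩)
    exact ⟨s, hs⟩
  choose! S hS using hz
  set τ := hinf.natEmbedding
  have hinj : ∀ p : Fin 3 → ℝ, M⁻¹ *ᵥ (M *ᵥ p) = p := fun p => by
    rw [Matrix.mulVec_mulVec, Matrix.nonsing_inv_mul _ hM, Matrix.one_mulVec]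
  have key : ∀ i j : Fin N, ∀ t : ℝ, M *ᵥ ![1 - S (τ i), S (τ i), τ i] =
      t • (M *ᵥ ![1 - S (τ j), S (τ j), τ j]) → i = j := by
    intro i j t h
    rw [← Matrix.mulVec_smul] at h
    have h2 := congrArg (fun p => M⁻¹ *ᵥ p) h
    simp only [hinj] at h2
    have e0 := congrFun h2 0
    have e1 := congrFun h2 1
    have e2 := congrFun h2 2
    simp at e0 e1 e2
    have ht : t = 1 := by linear_combination -e0 - e1
    rw [ht, one_mul] at e2
    have := τ.injective (Subtype.ext e2)
    exact Fin.ext this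
  refine ⟨fun i => M *ᵥ ![1 - S (τ i), S (τ i), τ i], fun i h => ?_, fun i j hij t h => hij (key i j t h),
    fun i => hS _ (τ i).2⟩
  have h2 := congrArg (fun p => M⁻¹ *ᵥ p) h
  simp only [hinj, Matrix.mulVec_zero] at h2
  have e0 := congrFun h2 0
  have e1 := congrFun h2 1
  simp at e0 e1
  linarith

lemma dvd_of_vanish {a f : MvPolynomial (Fin 3) ℝ} {n e : ℕ} (hn : n ≠ 0) (ha : a.IsHomogeneous n)
    (hirr : Irreducible a) (hi : Indef a) (hf : f.IsHomogeneous e)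
    (hv : ∀ p, eval p a = 0 → eval p f = 0) : a ∣ f := by
  by_contra hc
  obtain ⟨P, h1, h2, h3⟩ := many_zeros hn ha hi (n * e + 1)
  have := bezout_points ha hf hirr.prime hc P h1 h2 (fun i => hv _ (h3 i)) h3 ∅ (by simp)
  simp at this

lemma factor_dvd {a q : MvPolynomial (Fin 3) ℝ} {n e : ℕ} (hn : n ≠ 0) (ha : a.IsHomogeneous n)
    (hirr : Irreducible a) (hi : Indef a) (hq : q.IsHomogeneous e) (hpsd : Psd (a * q)) : a ∣ q := by
  by_contra hc
  have h1 : ∀ k, a ∣ pderiv k a := by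
    intro k
    have : a ∣ q * pderiv k a := dvd_of_vanish hn ha hirr hi (hq.mul (ha.pderiv (i := k))) (fun p hp => by
      have := psd_crit hpsd (u := p) (by simp [hp]) k
      rw [Derivation.leibniz] at this
      simpa [hp] using this)
    exact (hirr.prime.dvd_or_dvd this).resolve_left hc
  have h2 : ∀ k, pderiv k a = 0 := by
    intro k
    by_contra h0
    obtain ⟨c, hc⟩ := h1 k
    have hc0 : c ≠ 0 := by rintro rfl; simp at hc; exact h0 hc
    have d1 := (ha.pderiv (i := k)).totalDegree h0
    have d2 := ha.totalDegree hirr.ne_zero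
    rw [hc, totalDegree_mul_of_isDomain hirr.ne_zero hc0, d2] at d1
    omega
  have := ha.sum_X_mul_pderiv
  simp only [h2, mul_zero, Finset.sum_const_zero] at this
  have h3 : (n : ℕ) • a = 0 := this.symm
  rw [smul_eq_zero] at h3
  rcases h3 with h | h
  · exact hn h
  · exact hirr.ne_zero h

end RealFactor

end

section

open MvPolynomial

lemma hom0_unit {K : Type*} [Field K] {p : MvPolynomial (Fin 3) K} (h : p.IsHomogeneous 0) (h0 : p ≠ 0) :
    IsUnit p := by
  have h1 : p = C (coeff 0 p) := totalDegree_eq_zero_iff_eq_C.1 (by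
    have := h.totalDegree h0; exact this)
  rw [h1] at h0 ⊢
  have : coeff 0 p ≠ 0 := by
    intro h; rw [h] at h0; simp at h0
  exact (IsUnit.mk0 _ this).map C

lemma psd_cofactor {a b : MvPolynomial (Fin 3) ℝ} (ha0 : a ≠ 0) (ha : Psd a) (hg : Psd (a * b)) : Psd b := by
  refine dense_nonneg ha0 fun p hp => ?_
  have h1 := hg p
  rw [eval_mul] at h1
  have h2 : 0 < eval p a := lt_of_le_of_ne (ha p) (Ne.symm hp)
  exact nonneg_of_mul_nonneg_right h1 h2

lemma sos_of_factor {a b : MvPolynomial (Fin 3) ℝ} {n m : ℕ} (hirr : Irreducible a)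
    (ha : a.IsHomogeneous n) (hb : b.IsHomogeneous m) (hb0 : b ≠ 0) (hnm : n + m = 6) (hn : n ≠ 0) (hn3 : n ≤ 3)
    (hpsd : Psd (a * b)) : Sos (a * b) := by
  have ha0 := hirr.ne_zero
  by_cases hi : Indef a
  · obtain ⟨c, rfl⟩ := factor_dvd hn ha hirr hi hb hpsd
    obtain ⟨i, j, hij, h1, h2⟩ := homog_factor hb hb0
    have hin : n = i := ha.inj_right h1 ha0
    have hc : Psd c := by
      refine psd_cofactor (a := a * a) (mul_ne_zero ha0 ha0) (fun p => ?_) (by rwa [mul_assoc])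
      rw [eval_mul]; exact mul_self_nonneg _
    have hs : Sos c := by
      have : j = 4 ∨ j = 2 ∨ j = 0 := by omega
      rcases this with rfl | rfl | rfl
      · exact sos4 h2 hc
      · exact sos2 h2 hc
      · exact sos0 h2 hc
    have := (sos_sq a).mul hs
    rwa [pow_two, mul_assoc] at this
  · have hsg : Psd a ∨ Psd (-a) := by
      by_cases h : Psd a
      · exact Or.inl h
      · right
        unfold Psd at h; push Not at h
        intro v
        rw [map_neg]
        by_contra hv
        exact hi ⟨h, v, by linarith⟩
    have hn2 : n = 2 := by
      by_contra hne
      have hodd : Odd n := by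
        have : n = 1 ∨ n = 3 := by omega
        rcases this with rfl | rfl <;> decide
      obtain ⟨p, hp⟩ := exists_eval_ne ha0
      have h1 := eval_smul_form ha (-1) p
      rw [hodd.neg_one_pow] at h1
      rcases hsg with h | h
      · have h2 := h p; have h3 := h ((-1 : ℝ) • p)
        rw [h1] at h3
        apply hp; simp at h3; linarith
      · have h2 := h p; have h3 := h ((-1 : ℝ) • p)
        rw [map_neg] at h2 h3
        rw [h1] at h3
        apply hp; simp at h3 h2; linarith
    subst hn2
    obtain rfl : m = 4 := by omega
    rcases hsg with h | h
    · exact (sos2 ha h).mul (sos4 hb (psd_cofactor ha0 h hpsd))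
    · have h' : Psd (-b) := psd_cofactor (neg_ne_zero.2 ha0) h (by simpa using hpsd)
      have := (sos2 ha.neg h).mul (sos4 hb.neg h')
      simpa using this

theorem irr_real {g : MvPolynomial (Fin 3) ℝ} (hg : g.IsHomogeneous 6) (hpsd : Psd g) (hns : ¬ Sos g) :
    Irreducible g := by
  have hg0 : g ≠ 0 := by
    rintro rfl
    exact hns ⟨0, fun _ => 0, by simp⟩
  have key : ∀ p q : MvPolynomial (Fin 3) ℝ, ∀ i j, p.IsHomogeneous i → q.IsHomogeneous j → i + j = 6 → i ≤ 3 →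
      ¬ IsUnit p → g ≠ p * q := by
    intro p q i j hp hq hij hi hu hgpq
    have hp0 : p ≠ 0 := by rintro rfl; simp at hgpq; exact hg0 hgpq
    have hq0 : q ≠ 0 := by rintro rfl; simp at hgpq; exact hg0 hgpq
    obtain ⟨a, ha, r, rfl⟩ := WfDvdMonoid.exists_irreducible_factor hu hp0
    obtain ⟨n, m, hnm, h1, h2⟩ := homog_factor hp hp0
    have hn : n ≠ 0 := by
      rintro rfl
      exact ha.not_isUnit (hom0_unit h1 ha.ne_zero)
    apply hns
    rw [hgpq, mul_assoc]
    refine sos_of_factor ha h1 (h2.mul hq) ?_ (by omega) hn (by omega) ?_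
    · exact mul_ne_zero (right_ne_zero_of_mul hp0) hq0
    · rw [← mul_assoc, ← hgpq]; exact hpsd
  refine ⟨fun hu => ?_, fun p q hpq => ?_⟩
  · have h1 := hg.totalDegree hg0
    have := (MvPolynomial.isUnit_iff_totalDegree_of_isReduced.1 hu).2
    omega
  · by_contra hc
    push Not at hc
    obtain ⟨i, j, hij, h1, h2⟩ := homog_factor (hpq ▸ hg) (hpq ▸ hg0)
    by_cases hi : i ≤ 3
    · exact key p q i j h1 h2 hij hi hc.1 hpq
    · exact key q p j i h2 h1 (by omega) (by omega) hc.2 (by rw [hpq, mul_comm])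

lemma exists_re_im (A : MvPolynomial (Fin 3) ℂ) : ∃ a b : MvPolynomial (Fin 3) ℝ,
    A = MvPolynomial.map (algebraMap ℝ ℂ) a + C Complex.I * MvPolynomial.map (algebraMap ℝ ℂ) b := by
  induction A using MvPolynomial.induction_on with
  | C z =>
    refine ⟨C z.re, C z.im, ?_⟩
    rw [map_C, map_C, ← C_mul, ← C_add]
    congr 1
    apply Complex.ext <;> simp
  | add p q hp hq =>
    obtain ⟨a, b, rfl⟩ := hp
    obtain ⟨c, d, rfl⟩ := hq
    exact ⟨a + c, b + d, by simp only [map_add]; ring⟩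
  | mul_X p i hp =>
    obtain ⟨a, b, rfl⟩ := hp
    exact ⟨a * X i, b * X i, by simp only [map_mul, map_X]; ring⟩

lemma conj_map (a : MvPolynomial (Fin 3) ℝ) :
    MvPolynomial.map (starRingEnd ℂ) (MvPolynomial.map (algebraMap ℝ ℂ) a) = MvPolynomial.map (algebraMap ℝ ℂ) a := by
  rw [MvPolynomial.map_map]
  have h : (starRingEnd ℂ).comp (algebraMap ℝ ℂ) = algebraMap ℝ ℂ := by
    apply RingHom.ext
    intro x
    simp
  rw [h]

lemma norm_eq (a b : MvPolynomial (Fin 3) ℝ) {A : MvPolynomial (Fin 3) ℂ}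
    (h : A = MvPolynomial.map (algebraMap ℝ ℂ) a + C Complex.I * MvPolynomial.map (algebraMap ℝ ℂ) b) :
    A * MvPolynomial.map (starRingEnd ℂ) A = MvPolynomial.map (algebraMap ℝ ℂ) (a ^ 2 + b ^ 2) := by
  have hI : (C Complex.I * C Complex.I : MvPolynomial (Fin 3) ℂ) = -1 := by
    rw [← C_mul, Complex.I_mul_I]; simp
  rw [h]
  simp only [map_add, map_mul, conj_map, map_C, map_pow, Complex.conj_I, C_neg]
  linear_combination (-(MvPolynomial.map (algebraMap ℝ ℂ) b) ^ 2) * hI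

theorem irr_complex {g : MvPolynomial (Fin 3) ℝ} (hg : g.IsHomogeneous 6) (hpsd : Psd g) (hns : ¬ Sos g) :
    Irreducible (MvPolynomial.map (algebraMap ℝ ℂ) g) := by
  have hirr := irr_real hg hpsd hns
  have hg0 := hirr.ne_zero
  have hinj := MvPolynomial.map_injective (σ := Fin 3) (algebraMap ℝ ℂ) (algebraMap ℝ ℂ).injective
  have hG0 : MvPolynomial.map (algebraMap ℝ ℂ) g ≠ 0 := by
    intro h; exact hg0 (hinj (by simpa using h))
  have hG : (MvPolynomial.map (algebraMap ℝ ℂ) g).IsHomogeneous 6 := hg.map _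
  refine ⟨fun hu => ?_, fun A B hAB => ?_⟩
  · have h1 := hG.totalDegree hG0
    have := (MvPolynomial.isUnit_iff_totalDegree_of_isReduced.1 hu).2
    omega
  by_contra hc
  push Not at hc
  obtain ⟨i, j, hij, h1, h2⟩ := homog_factor (hAB ▸ hG) (hAB ▸ hG0)
  have hA0 : A ≠ 0 := by rintro rfl; simp only [zero_mul, mul_zero] at hAB; exact hG0 hAB
  have hB0 : B ≠ 0 := by rintro rfl; simp only [zero_mul, mul_zero] at hAB; exact hG0 hAB
  have hi : i ≠ 0 := by rintro rfl; exact hc.1 (hom0_unit h1 hA0)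
  have hj : j ≠ 0 := by rintro rfl; exact hc.2 (hom0_unit h2 hB0)
  obtain ⟨a, b, hA⟩ := exists_re_im A
  obtain ⟨c, d, hB⟩ := exists_re_im B
  have hNA := norm_eq a b hA
  have hNB := norm_eq c d hB
  have hprod : (a ^ 2 + b ^ 2) * (c ^ 2 + d ^ 2) = g ^ 2 := by
    apply hinj
    rw [map_mul, ← hNA, ← hNB, map_pow, pow_two]
    have h3 := conj_map g
    rw [hAB, map_mul] at h3
    rw [hAB]
    linear_combination (A * B) * h3
  have hcinj : Function.Injective (MvPolynomial.map (σ := Fin 3) (starRingEnd ℂ)) :=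
    MvPolynomial.map_injective _ (starRingEnd ℂ).injective
  have hA'0 : MvPolynomial.map (starRingEnd ℂ) A ≠ 0 := by
    intro h; exact hA0 (hcinj (by simpa using h))
  have hN0 : a ^ 2 + b ^ 2 ≠ 0 := by
    intro h
    rw [h, map_zero] at hNA
    exact (mul_ne_zero hA0 hA'0) hNA
  have hNhom : (a ^ 2 + b ^ 2).IsHomogeneous (i + i) := by
    have : (MvPolynomial.map (algebraMap ℝ ℂ) (a ^ 2 + b ^ 2)).IsHomogeneous (i + i) := by
      rw [← hNA]; exact h1.mul (h1.map _)
    exact (MvPolynomial.IsHomogeneous.of_map (algebraMap ℝ ℂ).injective this)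
  obtain ⟨k, hk, hass⟩ := (dvd_prime_pow hirr.prime 2).1 (Dvd.intro _ hprod)
  obtain ⟨w, hw⟩ := hass
  obtain ⟨hwC, -⟩ := MvPolynomial.isUnit_iff_eq_C_of_isReduced.1 w.isUnit |> fun ⟨r, hr, h⟩ => (⟨⟨r, hr, h⟩, trivial⟩ : (∃ r : ℝ, IsUnit r ∧ (w : MvPolynomial (Fin 3) ℝ) = C r) ∧ True)
  obtain ⟨r, hr, hwr⟩ := hwC
  rw [hwr] at hw
  have hhom2 : (g ^ k).IsHomogeneous (i + i) := by
    rw [← hw]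
    simpa using hNhom.mul (isHomogeneous_C (Fin 3) r)
  have hdeg := hhom2.inj_right (hg.pow k) (pow_ne_zero k hg0)
  have hk1 : k = 1 := by omega
  subst hk1
  rw [pow_one] at hw
  have hr0 : 0 ≤ r := by
    obtain ⟨p, hp⟩ := exists_eval_ne hN0
    have h3 := hpsd p
    rw [← hw] at h3
    rw [map_mul, eval_C] at h3
    have h4 : 0 < eval p (a ^ 2 + b ^ 2) := lt_of_le_of_ne (by simp; positivity) (Ne.symm hp)
    exact nonneg_of_mul_nonneg_right h3 h4
  apply hns
  rw [← hw]
  refine ((sos_sq a).add (sos_sq b)).mul ?_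
  have := sos_sq (C (Real.sqrt r))
  rwa [← C_pow, Real.sq_sqrt hr0] at this

theorem final_bound {g : MvPolynomial (Fin 3) ℝ} (hg : g.IsHomogeneous 6) (hpsd : Psd g) (hns : ¬ Sos g) :
    (VR g).encard ≤ 10 := by
  by_contra hc
  push Not at hc
  have h11 : (11 : ℕ∞) ≤ (VR g).encard := by
    have := Order.add_one_le_of_lt hc
    exact (by norm_num : (11 : ℕ∞) = 10 + 1) ▸ this
  obtain ⟨t, hts, htc⟩ := Set.exists_subset_encard_eq h11
  have hfin : t.Finite := Set.finite_of_encard_eq_coe (k := 11) htc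
  have hcard : hfin.toFinset.card = 11 := by
    rw [hfin.encard_eq_coe_toFinset_card] at htc
    exact_mod_cast htc
  let e := hfin.toFinset.equivFinOfCardEq hcard
  let Q : Fin 11 → P2 := fun i => (e.symm i : P2)
  have hQ : ∀ i, Q i ∈ VR g := fun i => hts (hfin.mem_toFinset.1 (e.symm i).2)
  have hQinj : Function.Injective Q := Subtype.val_injective.comp e.symm.injective
  let P : Fin 11 → Fin 3 → ℂ := fun i k => ((Q i).rep k : ℂ)
  have hev : ∀ i (f : MvPolynomial (Fin 3) ℝ), eval (P i) (MvPolynomial.map (algebraMap ℝ ℂ) f) = ((eval (Q i).rep f : ℝ) : ℂ) := by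
    intro i f
    rw [eval_map]
    exact (MvPolynomial.eval₂_comp_left (algebraMap ℝ ℂ) (RingHom.id ℝ) (Q i).rep f).symm
  refine no_eleven (hg.map (algebraMap ℝ ℂ)) (irr_complex hg hpsd hns) P ⟨?_, ?_, ?_⟩ ?_
  · intro i h
    apply (Q i).rep_nonzero
    ext k
    have : ((Q i).rep k : ℂ) = 0 := congrFun h k
    exact_mod_cast this
  · intro i j hij t h
    obtain ⟨k, hk⟩ := Function.ne_iff.1 (Q j).rep_nonzero
    have hk' : (Q j).rep k ≠ 0 := hk
    have ht : t = (((Q i).rep k / (Q j).rep k : ℝ) : ℂ) := by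
      have h1 := congrFun h k
      have h2 : ((Q j).rep k : ℂ) ≠ 0 := by exact_mod_cast hk'
      simp only [P, Pi.smul_apply, smul_eq_mul] at h1
      push_cast
      rw [eq_div_iff h2, ← h1]
    apply hij
    apply hQinj
    rw [← (Q i).mk_rep, ← (Q j).mk_rep]
    rw [Projectivization.mk_eq_mk_iff']
    refine ⟨(Q i).rep k / (Q j).rep k, ?_⟩
    ext l
    have h1 := congrFun h l
    rw [ht] at h1
    simp only [P, Pi.smul_apply, smul_eq_mul] at h1 ⊢
    exact_mod_cast h1.symm
  · intro i
    rw [hev]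
    have : eval (Q i).rep g = 0 := hQ i
    rw [this]; simp
  · intro i k
    rw [pderiv_map, hev, psd_crit hpsd (hQ i) k]; simp

end

theorem statement8 (g : MvPolynomial (Fin 3) ℝ) (hg6 : g.IsHomogeneous 6) (hpsd : Psd g)
    (hnsos : ¬ Sos g) :
    (VR g).encard ≤ 10 ∧
    (¬ Irreducible (MvPolynomial.map (algebraMap ℝ ℂ) g) → (VR g).encard ≤ 9) := by
  exact ⟨final_bound hg6 hpsd hnsos, fun h => absurd (irr_complex hg6 hpsd hnsos) h⟩

end
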